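/- The LP relaxation MFNLP of the capacitated facility location problem has integrality gap at most 288: for every CFL instance and every pair (x,y) feasible for MFNLP, there exists an integral solution (x̄,ȳ) to the CFL instance with c(x̄,ȳ) ≤ 288·c(x,y). -/

import Mathlib

/-!
Formalization of statements from "An LP-rounding approach to capacitated facility location".

`F` is the (finite) type of facilities, `D` the type of clients, `U i` the (positive integer)
capacity of facility `i`.  The multi-commodity flow network `MFN(g, x, y)` has nodes
`j^s, j^t` for clients `j` and `i, i'` for facilities `i`; its arcs and capacities are as in
`MFNArc` / `mfnCap` below.
-/

open scoped BigOperators Classical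

/-- Arcs of the multi-commodity flow network `MFN`:
`mid i` is the arc `(i, i')`, `sx j i` is `(j^s, i)`, `gs i j` is `(i, j^s)`,
and `ft i j` is `(i', j^t)`. -/
inductive MFNArc (F D : Type) where
  | mid : F → MFNArc F D
  | sx  : D → F → MFNArc F D
  | gs  : F → D → MFNArc F D
  | ft  : F → D → MFNArc F D
  deriving DecidableEq, Fintype

/-- Nodes of the multi-commodity flow network `MFN`. -/
inductive MFNNode (F D : Type) where
  | src  : D → MFNNode F D
  | fac  : F → MFNNode F D
  | fac' : F → MFNNode F D
  | sink : D → MFNNode F D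
  deriving DecidableEq

variable {F D : Type}

/-- Tail (start node) of an arc. -/
def MFNArc.tail : MFNArc F D → MFNNode F D
  | .mid i => .fac i
  | .sx j _ => .src j
  | .gs i _ => .fac i
  | .ft i _ => .fac' i

/-- Head (end node) of an arc. -/
def MFNArc.head : MFNArc F D → MFNNode F D
  | .mid i => .fac' i
  | .sx _ i => .fac i
  | .gs _ j => .src j
  | .ft _ j => .sink j

variable [Fintype F] [Fintype D]

/-- Capacity of each arc of `MFN(g, x, y)`; the demand of client `j` is
`d j = 1 - ∑ i, g i j`. -/
noncomputable def mfnCap (U : F → ℕ) (g x : F → D → ℝ) (y : F → ℝ) : MFNArc F D → ℝ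
  | .mid i  => y i * ((U i : ℝ) - ∑ j, g i j)
  | .sx j i => x i j
  | .gs i j => g i j
  | .ft i j => y i * (1 - ∑ i', g i' j)

/-- Net outflow of a (single-commodity) flow `f` at node `v`. -/
noncomputable def netOutflow (f : MFNArc F D → ℝ) (v : MFNNode F D) : ℝ :=
  ∑ a ∈ Finset.univ.filter (fun a : MFNArc F D => a.tail = v), f a -
    ∑ a ∈ Finset.univ.filter (fun a : MFNArc F D => a.head = v), f a

/-- `f = (f_j)_{j ∈ D}` is a feasible multi-commodity flow for `MFN(g, x, y)`:
each `f_j` is nonnegative, conserves flow at every node other than `j^s` and `j^t`,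
has net outflow `d j = 1 - ∑ i, g i j` at `j^s`, and the total flow on every arc is
at most its capacity. -/
def IsFeasibleFlow (U : F → ℕ) (g x : F → D → ℝ) (y : F → ℝ)
    (f : D → MFNArc F D → ℝ) : Prop :=
  (∀ j a, 0 ≤ f j a) ∧
  (∀ (j : D) (v : MFNNode F D), v ≠ MFNNode.src j → v ≠ MFNNode.sink j →
      netOutflow (f j) v = 0) ∧
  (∀ j : D, netOutflow (f j) (MFNNode.src j) = 1 - ∑ i, g i j) ∧
  (∀ a : MFNArc F D, ∑ j, f j a ≤ mfnCap U g x y a)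

/-- The multi-commodity flow network `MFN(g, x, y)` is feasible. -/
def MFNFeasible (U : F → ℕ) (g x : F → D → ℝ) (y : F → ℝ) : Prop :=
  ∃ f : D → MFNArc F D → ℝ, IsFeasibleFlow U g x y f

/-- `g` is a valid partial (fractional) assignment of clients to facilities. -/
def ValidAssign (U : F → ℕ) (g : F → D → ℝ) : Prop :=
  (∀ i j, 0 ≤ g i j) ∧ (∀ j, ∑ i, g i j ≤ 1) ∧ (∀ i, ∑ j, g i j ≤ (U i : ℝ))

/-- The cost of a (fractional) solution `(x, y)`: total opening cost plus total
connection cost. -/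
noncomputable def cflCost (o : F → ℝ) (c : F → D → ℝ) (x : F → D → ℝ) (y : F → ℝ) : ℝ :=
  ∑ i, o i * y i + ∑ i, ∑ j, c i j * x i j

/-- `(x, y)` is an integral solution of the capacitated facility location instance. -/
def IsIntegralSolution (U : F → ℕ) (x : F → D → ℝ) (y : F → ℝ) : Prop :=
  (∀ i j, x i j = 0 ∨ x i j = 1) ∧ (∀ i, y i = 0 ∨ y i = 1) ∧
  (∀ i j, x i j ≤ y i) ∧ (∀ j, ∑ i, x i j = 1) ∧
  (∀ i, ∑ j, x i j ≤ (U i : ℝ) * y i)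

lemma exists_exchange {z₁ z₂ e₁ e₂ f₁ f₂ : ℝ} (hz₁ : 0 ≤ z₁ ∧ z₁ ≤ 1) (hz₂ : 0 ≤ z₂ ∧ z₂ ≤ 1)
    (he₁ : 0 ≤ e₁) (he₂ : 0 ≤ e₂) (hf₁ : 0 ≤ f₁) (hf₂ : 0 ≤ f₂) :
    ∃ t₁ t₂ : ℝ, (0 ≤ t₁ ∧ t₁ ≤ 1) ∧ (0 ≤ t₂ ∧ t₂ ≤ 1) ∧
      t₁ * e₁ + t₂ * e₂ = z₁ * e₁ + z₂ * e₂ ∧ t₁ * f₁ + t₂ * f₂ ≤ z₁ * f₁ + z₂ * f₂ ∧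
      (t₁ = 0 ∨ t₁ = 1 ∨ t₂ = 0 ∨ t₂ = 1) := by
  wlog h : f₁ * e₂ ≤ f₂ * e₁ generalizing z₁ z₂ e₁ e₂ f₁ f₂
  · obtain ⟨t₂, t₁, h₂, h₁, he, hf, ht⟩ :=
      this hz₂ hz₁ he₂ he₁ hf₂ hf₁ (le_of_not_ge h)
    exact ⟨t₁, t₂, h₁, h₂, by linarith, by linarith, by tauto⟩
  rcases he₁.eq_or_lt with rfl | he₁
  · exact ⟨0, z₂, by simp, hz₂, by simp, by nlinarith [mul_nonneg hz₁.1 hf₁], by simp⟩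
  rcases he₂.eq_or_lt with rfl | he₂
  · exact ⟨z₁, 0, hz₁, by simp, by simp, by nlinarith [mul_nonneg hz₂.1 hf₂], by simp⟩
  have key : ∀ t : ℝ, 0 ≤ t → t / e₁ * f₁ ≤ t / e₂ * f₂ := by
    intro t ht
    rw [div_mul_eq_mul_div, div_mul_eq_mul_div, div_le_div_iff₀ he₁ he₂]
    nlinarith [mul_le_mul_of_nonneg_left h ht]
  rcases le_total ((1 - z₁) * e₁) (z₂ * e₂) with hle | hle
  · have ht : 0 ≤ (1 - z₁) * e₁ := mul_nonneg (by linarith) he₁.le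
    have hk := key _ ht
    rw [mul_div_cancel_right₀ _ he₁.ne'] at hk
    have h1 : (1 - z₁) * e₁ / e₂ ≤ z₂ := by rwa [div_le_iff₀ he₂]
    have h0 : 0 ≤ (1 - z₁) * e₁ / e₂ := by positivity
    refine ⟨1, z₂ - (1 - z₁) * e₁ / e₂, by simp, ⟨by linarith, by linarith⟩, ?_, ?_, by simp⟩
    · field_simp; ring
    · linarith
  · have ht : 0 ≤ z₂ * e₂ := mul_nonneg hz₂.1 he₂.le
    have hk := key _ ht
    rw [mul_div_cancel_right₀ _ he₂.ne'] at hk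
    have h1 : z₂ * e₂ / e₁ ≤ 1 - z₁ := by rwa [div_le_iff₀ he₁]
    have h0 : 0 ≤ z₂ * e₂ / e₁ := by positivity
    refine ⟨z₁ + z₂ * e₂ / e₁, 0, ⟨by linarith [hz₁.1], by linarith⟩, by simp, ?_, ?_, by simp⟩
    · field_simp; ring
    · linarith

/-- A fractional knapsack solution can be made integral in all but one coordinate. -/
lemma exists_knapsack_rounding {ι : Type*} [DecidableEq ι] (a : ι) (z e f : ι → ℝ)
    (T : Finset ι) (hz : ∀ i ∈ T, 0 ≤ z i ∧ z i ≤ 1) (he : ∀ i ∈ T, 0 ≤ e i)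
    (hf : ∀ i ∈ T, 0 ≤ f i) :
    ∃ P ⊆ T, ∃ (k : ι) (t : ℝ), (0 ≤ t ∧ t ≤ 1) ∧ ((k ∈ T ∧ k ∉ P) ∨ t = 0) ∧
      ∑ i ∈ P, e i + t * e k = ∑ i ∈ T, z i * e i ∧
      ∑ i ∈ P, f i + t * f k ≤ ∑ i ∈ T, z i * f i := by
  induction T using Finset.induction_on with
  | empty => exact ⟨∅, by simp, a, 0, by simp, by simp, by simp, by simp⟩
  | insert b T hb ih =>
    obtain ⟨P, hP, k, t, ht, hk, hpe, hpf⟩ := ih (fun i hi => hz i (Finset.mem_insert_of_mem hi))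
      (fun i hi => he i (Finset.mem_insert_of_mem hi))
      (fun i hi => hf i (Finset.mem_insert_of_mem hi))
    have hzb := hz b (Finset.mem_insert_self _ _)
    have heb := he b (Finset.mem_insert_self _ _)
    have hfb := hf b (Finset.mem_insert_self _ _)
    have hbP : b ∉ P := fun h => hb (hP h)
    have hPT : P ⊆ insert b T := hP.trans (Finset.subset_insert _ _)
    rw [Finset.sum_insert hb, Finset.sum_insert hb]
    rcases hk with ⟨hkT, hkP⟩ | rfl
    · obtain ⟨t₁, t₂, h₁, h₂, h3, h4, h5⟩ := exists_exchange ht hzb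
        (he k (Finset.mem_insert_of_mem hkT)) heb (hf k (Finset.mem_insert_of_mem hkT)) hfb
      have hbk : b ≠ k := fun h => hb (h ▸ hkT)
      rcases h5 with rfl | rfl | rfl | rfl
      · exact ⟨P, hPT, b, t₂, h₂, Or.inl ⟨Finset.mem_insert_self _ _, hbP⟩,
          by linarith, by linarith⟩
      · refine ⟨insert k P, Finset.insert_subset (Finset.mem_insert_of_mem hkT) hPT, b, t₂, h₂,
          Or.inl ⟨Finset.mem_insert_self _ _, by simp [hbk, hbP]⟩, ?_, ?_⟩ <;>
        · rw [Finset.sum_insert hkP]; linarith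
      · exact ⟨P, hPT, k, t₁, h₁, Or.inl ⟨Finset.mem_insert_of_mem hkT, hkP⟩,
          by linarith, by linarith⟩
      · refine ⟨insert b P, Finset.insert_subset_insert _ hP, k, t₁, h₁,
          Or.inl ⟨Finset.mem_insert_of_mem hkT, by simp [hbk.symm, hkP]⟩, ?_, ?_⟩ <;>
        · rw [Finset.sum_insert hbP]; linarith
    · exact ⟨P, hPT, b, z b, hzb, Or.inl ⟨Finset.mem_insert_self _ _, hbP⟩,
        by linarith, by linarith⟩

/-- Rounding of the facilities of a star: the load `w` of the facilities in `T` is moved to an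
integrally opened subset `P` of `T`, up to a remainder that the centre `a` absorbs. -/
lemma exists_star_rounding {ι : Type*} [Fintype ι] [DecidableEq ι] (a : ι) (T : Finset ι)
    (z w U o δ : ι → ℝ) (hz : ∀ i ∈ T, 0 ≤ z i ∧ z i ≤ 1) (hw : ∀ i ∈ T, 0 ≤ w i)
    (hwU : ∀ i ∈ T, w i ≤ z i * U i / 2) (hU : ∀ i, 0 ≤ U i) (hUa : ∀ i ∈ T, U i ≤ U a)
    (ho : ∀ i, 0 ≤ o i) (hδ : ∀ i, 0 ≤ δ i) (hδa : δ a = 0) :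
    ∃ P ⊆ T, ∃ q : ι → ℝ, (∀ k, 0 ≤ q k) ∧ (∀ k, k ∉ P → k ≠ a → q k = 0) ∧
      ∑ k, q k = ∑ i ∈ T, w i ∧
      (∀ k, q k ≤ (if k ∈ P then U k / 2 else 0) + (if k = a then U k / 2 else 0)) ∧
      ∑ k ∈ P, o k + ∑ k, q k * δ k ≤ ∑ i ∈ T, (z i * o i + w i * δ i) := by
  have hze : ∀ i ∈ T, z i * (w i / z i) = w i := by
    intro i hi
    rcases eq_or_ne (z i) 0 with h | h
    · have h1 := hwU i hi
      have h2 := hw i hi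
      rw [h] at h1 ⊢
      linarith
    · field_simp
  have heU : ∀ i ∈ T, w i / z i ≤ U i / 2 := by
    intro i hi
    rcases (hz i hi).1.eq_or_lt with h | h
    · rw [← h, div_zero]; linarith [hU i]
    · rw [div_le_iff₀ h]; linarith [hwU i hi]
  have he0 : ∀ i ∈ T, 0 ≤ w i / z i := fun i hi => div_nonneg (hw i hi) (hz i hi).1
  obtain ⟨P, hP, k, t, ht, hk, hpe, hpf⟩ := exists_knapsack_rounding a z (fun i => w i / z i)
    (fun i => o i + w i / z i * δ i) T hz he0
    (fun i hi => add_nonneg (ho i) (mul_nonneg (he0 i hi) (hδ i)))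
  have hr0 : 0 ≤ t * (w k / z k) := by
    rcases hk with hk | rfl
    · exact mul_nonneg ht.1 (he0 k hk.1)
    · simp
  have hrU : t * (w k / z k) ≤ U a / 2 := by
    rcases hk with hk | rfl
    · nlinarith [heU k hk.1, hUa k hk.1, he0 k hk.1, ht.2]
    · rw [zero_mul]; linarith [hU a]
  have hrf : 0 ≤ t * (o k + w k / z k * δ k) := by
    rcases hk with hk | rfl
    · exact mul_nonneg ht.1 (add_nonneg (ho k) (mul_nonneg (he0 k hk.1) (hδ k)))
    · simp
  refine ⟨P, hP, fun i => (if i ∈ P then w i / z i else 0) +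
    (if i = a then t * (w k / z k) else 0), ?_, ?_, ?_, ?_, ?_⟩
  · intro i
    have h1 : 0 ≤ if i ∈ P then w i / z i else 0 := by
      split_ifs with h
      · exact he0 i (hP h)
      · exact le_rfl
    have h2 : 0 ≤ if i = a then t * (w k / z k) else 0 := by
      split_ifs
      · exact hr0
      · exact le_rfl
    exact add_nonneg h1 h2
  · intro i h1 h2
    simp [h1, h2]
  · rw [Finset.sum_add_distrib]
    simp only [Finset.sum_ite_mem, Finset.univ_inter, Finset.sum_ite_eq', Finset.mem_univ, if_true]
    rw [hpe]
    exact Finset.sum_congr rfl hze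
  · intro i
    refine add_le_add ?_ ?_
    · split_ifs with h
      · exact heU i (hP h)
      · exact le_rfl
    · split_ifs with h
      · rw [h]; exact hrU
      · exact le_rfl
  · have h1 : ∑ i, ((if i ∈ P then w i / z i else 0) + (if i = a then t * (w k / z k) else 0)) * δ i
        = ∑ i ∈ P, w i / z i * δ i := by
      simp only [add_mul, ite_mul, zero_mul, Finset.sum_add_distrib, Finset.sum_ite_mem,
        Finset.univ_inter, Finset.sum_ite_eq', Finset.mem_univ, if_true, hδa, mul_zero, add_zero]
    rw [h1, ← Finset.sum_add_distrib]
    have h2 : ∑ i ∈ T, z i * (o i + w i / z i * δ i) = ∑ i ∈ T, (z i * o i + w i * δ i) :=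
      Finset.sum_congr rfl fun i hi => by rw [mul_add, ← mul_assoc, hze i hi]
    linarith

/-- Greedy dual ascent for covering the sets `H j`, processing the `j ∈ s` by increasing `R`. -/
lemma exists_tight_duals {J ι : Type*} [DecidableEq J] [DecidableEq ι] (s : Finset J)
    (H : J → Finset ι) (R : J → ℝ) (o : ι → ℝ) (ho : ∀ i, 0 ≤ o i)
    (hH : ∀ j ∈ s, (H j).Nonempty) :
    ∃ p : J → ℝ, (∀ j, 0 ≤ p j) ∧ (∀ j, j ∉ s → p j = 0) ∧
      (∀ i, ∑ j ∈ s, (if i ∈ H j then p j else 0) ≤ o i) ∧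
      ∀ j ∈ s, ∃ i ∈ H j, ∑ j' ∈ s, (if i ∈ H j' then p j' else 0) = o i ∧
        ∀ j' ∈ s, i ∈ H j' → 0 < p j' → R j' ≤ R j := by
  induction s using Finset.induction_on_max_value R with
  | empty => exact ⟨0, by simp, by simp, by simpa using ho, by simp⟩
  | insert a s has hR ih =>
    obtain ⟨p, hp0, hps, hpo, hpt⟩ := ih fun j hj => hH j (Finset.mem_insert_of_mem hj)
    obtain ⟨i₀, hi₀, hmin⟩ := Finset.exists_min_image (H a)
      (fun i => o i - ∑ j ∈ s, (if i ∈ H j then p j else 0)) (hH a (Finset.mem_insert_self _ _))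
    set t := o i₀ - ∑ j ∈ s, (if i₀ ∈ H j then p j else 0) with ht
    have ht0 : 0 ≤ t := by linarith [hpo i₀]
    have hne : ∀ j ∈ s, j ≠ a := fun j hj h => has (h ▸ hj)
    have hsum : ∀ i, ∑ j ∈ insert a s, (if i ∈ H j then Function.update p a t j else 0) =
        (if i ∈ H a then t else 0) + ∑ j ∈ s, (if i ∈ H j then p j else 0) := by
      intro i
      rw [Finset.sum_insert has, Function.update_self]
      congr 1
      exact Finset.sum_congr rfl fun j hj => by rw [Function.update_of_ne (hne j hj)]
    refine ⟨Function.update p a t, ?_, ?_, ?_, ?_⟩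
    · intro j
      rcases eq_or_ne j a with rfl | h
      · simpa using ht0
      · simpa [h] using hp0 j
    · intro j hj
      rw [Finset.mem_insert, not_or] at hj
      rw [Function.update_of_ne hj.1]
      exact hps j hj.2
    · intro i
      rw [hsum]
      split_ifs with h
      · linarith [hmin i h]
      · linarith [hpo i]
    · intro j hj
      rcases Finset.mem_insert.1 hj with rfl | hj
      · refine ⟨i₀, hi₀, ?_, ?_⟩
        · rw [hsum, if_pos hi₀, ht]
          ring
        · intro j' hj' _ _
          rcases Finset.mem_insert.1 hj' with rfl | hj'
          · exact le_rfl
          · exact hR j' hj'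
      · obtain ⟨i, hij, hti, hRi⟩ := hpt j hj
        have hta : i ∈ H a → t = 0 := fun h => le_antisymm (by linarith [hmin i h]) ht0
        refine ⟨i, hij, ?_, ?_⟩
        · rw [hsum, hti]
          split_ifs with h
          · rw [hta h, zero_add]
          · rw [zero_add]
        · intro j' hj' hij' hpj'
          rcases Finset.mem_insert.1 hj' with rfl | hj'
          · rw [Function.update_self, hta hij'] at hpj'
            exact absurd hpj' (lt_irrefl _)
          · rw [Function.update_of_ne (hne j' hj')] at hpj'
            exact hRi j' hj' hij' hpj'

/-- A maximal independent set chosen greedily by decreasing `U`. -/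
lemma exists_dominating_independent {ι : Type*} [DecidableEq ι] (r : ι → ι → Prop)
    (hr : ∀ a b, r a b → r b a) (U : ι → ℝ) (T : Finset ι) :
    ∃ O ⊆ T, (∀ a ∈ O, ∀ b ∈ O, a ≠ b → ¬ r a b) ∧
      ∀ i ∈ T, ∃ a ∈ O, (a = i ∨ r i a) ∧ U i ≤ U a := by
  induction T using Finset.induction_on_min_value U with
  | empty => exact ⟨∅, by simp, by simp, by simp⟩
  | insert b T hb hU ih =>
    obtain ⟨O, hOT, hind, hdom⟩ := ih
    by_cases h : ∃ a ∈ O, r b a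
    · obtain ⟨a, ha, hba⟩ := h
      refine ⟨O, hOT.trans (Finset.subset_insert _ _), hind, ?_⟩
      intro i hi
      rcases Finset.mem_insert.1 hi with rfl | hi
      · exact ⟨a, ha, Or.inr hba, hU a (hOT ha)⟩
      · exact hdom i hi
    · push Not at h
      refine ⟨insert b O, Finset.insert_subset_insert _ hOT, ?_, ?_⟩
      · intro a ha c hc hac
        rcases Finset.mem_insert.1 ha with rfl | ha₁ <;>
          rcases Finset.mem_insert.1 hc with rfl | hc₁
        · exact absurd rfl hac
        · exact h c hc₁
        · exact fun h' => h a ha₁ (hr _ _ h')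
        · exact hind a ha₁ c hc₁ hac
      · intro i hi
        rcases Finset.mem_insert.1 hi with rfl | hi
        · exact ⟨i, Finset.mem_insert_self _ _, Or.inl rfl, le_rfl⟩
        · obtain ⟨a, ha, hia⟩ := hdom i hi
          exact ⟨a, Finset.mem_insert_of_mem ha, hia⟩

/-- Rounding of a fractional cover: every `j ∈ s` finds a member of the cover at distance at most
two sets, whose level is at least that of some member of `H j`. -/
lemma exists_cover_rounding {J ι : Type*} [Fintype ι] [DecidableEq J] [DecidableEq ι]
    (s : Finset J) (H : J → Finset ι) (R : J → ℝ) (U o z : ι → ℝ) (ho : ∀ i, 0 ≤ o i)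
    (hz : ∀ i, 0 ≤ z i) {τ : ℝ} (hτ : 0 < τ) (hcov : ∀ j ∈ s, τ ≤ ∑ i ∈ H j, z i) :
    ∃ O : Finset ι, (∀ i ∈ O, ∃ j ∈ s, i ∈ H j) ∧ τ * ∑ i ∈ O, o i ≤ ∑ i, z i * o i ∧
      ∀ j ∈ s, ∃ a ∈ O, ∃ i ∈ H j, ∃ j' ∈ s, R j' ≤ R j ∧ i ∈ H j' ∧ a ∈ H j' ∧ U i ≤ U a := by
  have hne : ∀ j ∈ s, (H j).Nonempty := by
    intro j hj
    rw [Finset.nonempty_iff_ne_empty]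
    intro h
    have := hcov j hj
    rw [h, Finset.sum_empty] at this
    linarith
  obtain ⟨p, hp0, hps, hpo, hpt⟩ := exists_tight_duals s H R o ho hne
  obtain ⟨O, hOT, hind, hdom⟩ := exists_dominating_independent
    (fun i i' => ∃ j ∈ s, 0 < p j ∧ i ∈ H j ∧ i' ∈ H j)
    (fun a b ⟨j, hj, h0, ha, hb⟩ => ⟨j, hj, h0, hb, ha⟩) U
    ((s.biUnion H).filter fun i => ∑ j ∈ s, (if i ∈ H j then p j else 0) = o i)
  refine ⟨O, ?_, ?_, ?_⟩
  · intro i hi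
    have := hOT hi
    simpa using (Finset.mem_filter.1 this).1
  · have h1 : ∑ i ∈ O, o i ≤ ∑ j ∈ s, p j := by
      have : ∑ i ∈ O, o i = ∑ i ∈ O, ∑ j ∈ s, (if i ∈ H j then p j else 0) :=
        Finset.sum_congr rfl fun i hi => (Finset.mem_filter.1 (hOT hi)).2.symm
      rw [this, Finset.sum_comm]
      refine Finset.sum_le_sum fun j hj => ?_
      rw [← Finset.sum_filter, Finset.sum_const, nsmul_eq_mul]
      rcases (hp0 j).eq_or_lt with h | h
      · rw [← h, mul_zero]
      · have hc : (O.filter fun i => i ∈ H j).card ≤ 1 := by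
          refine Finset.card_le_one.2 fun a ha b hb => ?_
          rw [Finset.mem_filter] at ha hb
          by_contra hab
          exact hind a ha.1 b hb.1 hab ⟨j, hj, h, ha.2, hb.2⟩
        have hc' : ((O.filter fun i => i ∈ H j).card : ℝ) ≤ 1 := by exact_mod_cast hc
        nlinarith
    have h2 : ∑ j ∈ s, τ * p j ≤ ∑ i, z i * o i := by
      calc ∑ j ∈ s, τ * p j ≤ ∑ j ∈ s, (∑ i ∈ H j, z i) * p j :=
            Finset.sum_le_sum fun j hj => mul_le_mul_of_nonneg_right (hcov j hj) (hp0 j)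
        _ = ∑ j ∈ s, ∑ i, z i * (if i ∈ H j then p j else 0) := by
            refine Finset.sum_congr rfl fun j _ => ?_
            simp only [mul_ite, mul_zero, Finset.sum_ite_mem, Finset.univ_inter, Finset.sum_mul]
        _ = ∑ i, z i * ∑ j ∈ s, (if i ∈ H j then p j else 0) := by
            rw [Finset.sum_comm]
            exact Finset.sum_congr rfl fun i _ => (Finset.mul_sum _ _ _).symm
        _ ≤ _ := Finset.sum_le_sum fun i _ => mul_le_mul_of_nonneg_left (hpo i) (hz i)
    rw [← Finset.mul_sum] at h2
    exact (mul_le_mul_of_nonneg_left h1 hτ.le).trans h2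
  · intro j hj
    obtain ⟨i, hij, hti, hRi⟩ := hpt j hj
    obtain ⟨a, ha, har, hUa⟩ := hdom i (Finset.mem_filter.2
      ⟨Finset.mem_biUnion.2 ⟨j, hj, hij⟩, hti⟩)
    rcases har with rfl | ⟨j', hj', h0, hi', ha'⟩
    · exact ⟨a, ha, a, hij, j, hj, le_rfl, hij, hij, le_rfl⟩
    · exact ⟨a, ha, i, hij, j', hj', hRi j' hj' hi' h0, hi', ha', hUa⟩

set_option maxHeartbeats 800000 in
/-- Consolidation of a fractional assignment `ξ` along stars with centres `α i`. -/
lemma exists_star_consolidation {ι J : Type*} [Fintype ι] [Fintype J] [DecidableEq ι]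
    (U : ι → ℕ) (o z : ι → ℝ) (ho : ∀ i, 0 ≤ o i) (hz0 : ∀ i, 0 ≤ z i) (hz1 : ∀ i, z i ≤ 1 / 4)
    (c : ι → J → ℝ) (δ : ι → ι → ℝ) (hδ : ∀ a i, 0 ≤ δ a i) (hδ0 : ∀ a, δ a a = 0)
    (hcδ : ∀ a i k j, c k j ≤ c i j + δ a i + δ a k)
    (ξ : ι → J → ℝ) (hξ : ∀ i j, 0 ≤ ξ i j) (O₁ : Finset ι) (α : ι → ι)
    (hα : ∀ i, 0 < ∑ j, ξ i j → α i ∈ O₁ ∧ U i ≤ U (α i))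
    (hload : ∀ i, ∑ j, ξ i j ≤ 2 * (z i * U i)) :
    ∃ (O : Finset ι) (X : ι → J → ℝ), (∀ i j, 0 ≤ X i j) ∧ (∀ i j, i ∉ O → X i j = 0) ∧
      (∀ j, ∑ i, X i j = ∑ i, ξ i j) ∧ (∀ i, ∑ j, X i j ≤ U i) ∧
      (∀ i ∈ O, i ∈ O₁ ∨ 0 < ∑ j, ξ i j) ∧
      ∑ i ∈ O, o i + ∑ i, ∑ j, c i j * X i j ≤
        ∑ i ∈ O₁, o i + 4 * ∑ i, z i * o i + ∑ i, ∑ j, ξ i j * (c i j + 2 * δ (α i) i) := by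
  classical
  set w : ι → ℝ := fun i => ∑ j, ξ i j with hw
  have hw0 : ∀ i, 0 ≤ w i := fun i => Finset.sum_nonneg fun j _ => hξ i j
  set S : Finset ι := Finset.univ.filter fun i => 0 < w i with hS
  have hξS : ∀ i, i ∉ S → ∀ j, ξ i j = 0 := by
    intro i hi j
    have h : w i = 0 := le_antisymm (by simpa [hS] using hi) (hw0 i)
    exact (Finset.sum_eq_zero_iff_of_nonneg fun j _ => hξ i j).1 h j (Finset.mem_univ _)
  set T : ι → Finset ι := fun a => S.filter fun i => α i = a with hT
  have hTα : ∀ a, ∀ i ∈ T a, i ∈ S ∧ α i = a := fun a i hi => Finset.mem_filter.1 hi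
  have hstar := fun a => exists_star_rounding a (T a) (fun i => 4 * z i) w (fun i => (U i : ℝ)) o
    (δ a) (fun i _ => ⟨by linarith [hz0 i], by linarith [hz1 i]⟩) (fun i _ => hw0 i)
    (fun i _ => by linarith [hload i]) (fun i => Nat.cast_nonneg _)
    (fun i hi => by
      have h := hTα a i hi
      have h2 := (hα i (Finset.mem_filter.1 h.1).2).2
      rw [h.2] at h2
      exact_mod_cast h2) ho (hδ a) (hδ0 a)
  choose P hPT q hq0 hqs hqw hqU hqc using hstar
  set W : ι → ℝ := fun a => ∑ i ∈ T a, w i with hW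
  have hW0 : ∀ a, 0 ≤ W a := fun a => Finset.sum_nonneg fun i _ => hw0 i
  have hWpos : ∀ i ∈ S, 0 < W (α i) := fun i hi =>
    (Finset.mem_filter.1 hi).2.trans_le
      (Finset.single_le_sum (fun i _ => hw0 i) (Finset.mem_filter.2 ⟨hi, rfl⟩))
  have hfib : ∀ f : ι → ℝ, (∀ a, 0 ≤ f a) → ∑ i ∈ S, w i * (f (α i) / W (α i)) ≤ ∑ a, f a := by
    intro f hf
    rw [← Finset.sum_fiberwise S α]
    refine Finset.sum_le_sum fun a _ => ?_
    have : ∑ i ∈ S with α i = a, w i * (f (α i) / W (α i)) = W a * (f a / W a) := by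
      rw [hW, Finset.sum_mul]
      exact Finset.sum_congr rfl fun i hi => by rw [(hTα a i hi).2]
    rw [this]
    rcases (hW0 a).eq_or_lt with h | h
    · rw [← h, zero_mul]
      exact hf a
    · rw [mul_div_cancel₀ _ h.ne']
  have hp0 : ∀ i k, 0 ≤ q (α i) k / W (α i) := fun i k => div_nonneg (hq0 _ _) (hW0 _)
  have hp1 : ∀ i ∈ S, ∑ k, q (α i) k / W (α i) = 1 := by
    intro i hi
    rw [← Finset.sum_div, hqw]
    exact div_self (hWpos i hi).ne'
  have hsS : ∀ f : ι → ℝ, (∀ i, i ∉ S → f i = 0) → ∑ i ∈ S, f i = ∑ i, f i := fun f hf =>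
    Finset.sum_subset (Finset.subset_univ _) fun i _ hi => hf i hi
  refine ⟨O₁ ∪ Finset.univ.biUnion P, fun k j => ∑ i ∈ S, ξ i j * (q (α i) k / W (α i)),
    ?_, ?_, ?_, ?_, ?_, ?_⟩
  · exact fun k j => Finset.sum_nonneg fun i _ => mul_nonneg (hξ i j) (hp0 i k)
  · intro k j hk
    refine Finset.sum_eq_zero fun i hi => ?_
    rw [Finset.mem_union, not_or, Finset.mem_biUnion] at hk
    have h1 : k ∉ P (α i) := fun h => hk.2 ⟨_, Finset.mem_univ _, h⟩
    have h2 : k ≠ α i := by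
      rintro rfl
      exact hk.1 (hα i (Finset.mem_filter.1 hi).2).1
    rw [hqs _ _ h1 h2]
    simp
  · intro j
    rw [Finset.sum_comm, ← hsS (fun i => ξ i j) fun i hi => hξS i hi j]
    refine Finset.sum_congr rfl fun i hi => ?_
    rw [← Finset.mul_sum, hp1 i hi, mul_one]
  · intro k
    rw [Finset.sum_comm]
    have h1 : ∑ i ∈ S, ∑ j, ξ i j * (q (α i) k / W (α i)) =
        ∑ i ∈ S, w i * ((fun a => q a k) (α i) / W (α i)) :=
      Finset.sum_congr rfl fun i _ => (Finset.sum_mul _ _ _).symm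
    rw [h1]
    refine (hfib (fun a => q a k) fun a => hq0 a k).trans ?_
    have h2 : ∀ a, q a k ≤ (if a = α k then (U k : ℝ) / 2 else 0) +
        (if a = k then (U k : ℝ) / 2 else 0) := by
      intro a
      refine (hqU a k).trans (add_le_add ?_ ?_)
      · by_cases h : k ∈ P a
        · rw [if_pos h, if_pos (hTα a k (hPT a h)).2.symm]
        · rw [if_neg h]
          split_ifs <;> positivity
      · simp only [eq_comm, le_refl]
    refine (Finset.sum_le_sum fun a _ => h2 a).trans ?_
    rw [Finset.sum_add_distrib]
    simp only [Finset.sum_ite_eq', Finset.mem_univ, if_true]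
    linarith
  · intro i hi
    rcases Finset.mem_union.1 hi with h | h
    · exact Or.inl h
    · obtain ⟨a, -, ha⟩ := Finset.mem_biUnion.1 h
      exact Or.inr (Finset.mem_filter.1 (hTα a i (hPT a ha)).1).2
  · have hopen : ∑ i ∈ O₁ ∪ Finset.univ.biUnion P, o i ≤ ∑ i ∈ O₁, o i + ∑ a, ∑ i ∈ P a, o i := by
      have h1 := Finset.sum_union_inter (s₁ := O₁) (s₂ := Finset.univ.biUnion P) (f := o)
      have h2 : 0 ≤ ∑ i ∈ O₁ ∩ Finset.univ.biUnion P, o i := Finset.sum_nonneg fun i _ => ho i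
      have h3 : ∑ i ∈ Finset.univ.biUnion P, o i = ∑ a, ∑ i ∈ P a, o i := by
        refine Finset.sum_biUnion fun a _ b _ hab => ?_
        refine Finset.disjoint_left.2 fun i hi hi' => hab ?_
        rw [← (hTα a i (hPT a hi)).2, (hTα b i (hPT b hi')).2]
      linarith
    have hstars : ∑ a, ∑ i ∈ P a, o i + ∑ a, ∑ k, q a k * δ a k ≤
        4 * ∑ i, z i * o i + ∑ i, w i * δ (α i) i := by
      rw [← Finset.sum_add_distrib]
      refine (Finset.sum_le_sum fun a _ => hqc a).trans ?_
      have h1 : ∀ a, ∑ i ∈ T a, (4 * z i * o i + w i * δ a i) =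
          ∑ i ∈ S with α i = a, (4 * z i * o i + w i * δ (α i) i) := fun a =>
        Finset.sum_congr rfl fun i hi => by rw [(hTα a i hi).2]
      rw [Finset.sum_congr rfl fun a _ => h1 a, Finset.sum_fiberwise S α, Finset.mul_sum,
        ← Finset.sum_add_distrib]
      refine (Finset.sum_le_sum_of_subset_of_nonneg (Finset.subset_univ S) fun i _ _ =>
        add_nonneg (mul_nonneg (mul_nonneg (by norm_num) (hz0 i)) (ho i))
          (mul_nonneg (hw0 i) (hδ _ _))).trans (le_of_eq ?_)
      exact Finset.sum_congr rfl fun i _ => by ring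
    have hconn : ∑ k, ∑ j, c k j * ∑ i ∈ S, ξ i j * (q (α i) k / W (α i)) ≤
        ∑ i, ∑ j, ξ i j * (c i j + δ (α i) i) + ∑ a, ∑ k, q a k * δ a k := by
      calc ∑ k, ∑ j, c k j * ∑ i ∈ S, ξ i j * (q (α i) k / W (α i))
          = ∑ i ∈ S, ∑ j, ∑ k, c k j * (ξ i j * (q (α i) k / W (α i))) := by
            simp only [Finset.mul_sum]
            rw [Finset.sum_congr rfl fun k _ => Finset.sum_comm, Finset.sum_comm]
            exact Finset.sum_congr rfl fun i _ => Finset.sum_comm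
        _ ≤ ∑ i ∈ S, ∑ j, ∑ k, (c i j + δ (α i) i + δ (α i) k) *
              (ξ i j * (q (α i) k / W (α i))) :=
            Finset.sum_le_sum fun i _ => Finset.sum_le_sum fun j _ => Finset.sum_le_sum fun k _ =>
              mul_le_mul_of_nonneg_right (hcδ _ _ _ _) (mul_nonneg (hξ i j) (hp0 i k))
        _ = ∑ i ∈ S, (∑ j, ξ i j * (c i j + δ (α i) i) +
              w i * ((fun a => ∑ k, q a k * δ a k) (α i) / W (α i))) := by
            refine Finset.sum_congr rfl fun i hi => ?_
            rw [hw, Finset.sum_mul, ← Finset.sum_add_distrib]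
            refine Finset.sum_congr rfl fun j _ => ?_
            have h1 : ∀ k, (c i j + δ (α i) i + δ (α i) k) * (ξ i j * (q (α i) k / W (α i))) =
                ξ i j * (c i j + δ (α i) i) * (q (α i) k / W (α i)) +
                  ξ i j * (q (α i) k * δ (α i) k / W (α i)) := fun k => by ring
            rw [Finset.sum_congr rfl fun k _ => h1 k, Finset.sum_add_distrib, ← Finset.mul_sum,
              ← Finset.mul_sum, hp1 i hi, mul_one, ← Finset.sum_div]
        _ ≤ _ := by
            rw [Finset.sum_add_distrib]
            refine add_le_add (le_of_eq ?_) (hfib (fun a => ∑ k, q a k * δ a k) fun a =>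
              Finset.sum_nonneg fun k _ => mul_nonneg (hq0 _ _) (hδ _ _))
            exact hsS (fun i => ∑ j, ξ i j * (c i j + δ (α i) i)) fun i hi =>
              Finset.sum_eq_zero fun j _ => by rw [hξS i hi j, zero_mul]
    have hsplit : ∑ i, ∑ j, ξ i j * (c i j + 2 * δ (α i) i) =
        ∑ i, ∑ j, ξ i j * (c i j + δ (α i) i) + ∑ i, w i * δ (α i) i := by
      rw [← Finset.sum_add_distrib]
      refine Finset.sum_congr rfl fun i _ => ?_
      rw [hw, Finset.sum_mul, ← Finset.sum_add_distrib]
      exact Finset.sum_congr rfl fun j _ => by ring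
    linarith

lemma exists_weighted_median {ι : Type*} [Fintype ι] (U : ι → ℕ) (v : ι → ℝ)
    (hv : ∀ i, 0 ≤ v i) :
    ∃ m : ℕ, ∑ i, v i ≤ 2 * ∑ i, (if U i ≤ m then v i else 0) ∧
      ∑ i, v i ≤ 2 * ∑ i, (if m ≤ U i then v i else 0) := by
  have hv0 : 0 ≤ ∑ i, v i := Finset.sum_nonneg fun i _ => hv i
  have hex : ∃ m : ℕ, ∑ i, v i ≤ 2 * ∑ i, (if U i ≤ m then v i else 0) := by
    refine ⟨Finset.univ.sup U, ?_⟩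
    rw [Finset.sum_congr rfl fun i _ => if_pos (Finset.le_sup (Finset.mem_univ i))]
    linarith
  refine ⟨Nat.find hex, Nat.find_spec hex, ?_⟩
  have hmin := fun k => Nat.find_min (H := hex) (m := k)
  generalize Nat.find hex = m at hmin ⊢
  rcases m with _ | k
  · simp only [Nat.zero_le, if_true]
    linarith
  · have hk := hmin k (Nat.lt_succ_self k)
    have hsplit : ∑ i, v i = ∑ i, (if U i ≤ k then v i else 0) +
        ∑ i, (if k + 1 ≤ U i then v i else 0) := by
      rw [← Finset.sum_add_distrib]
      refine Finset.sum_congr rfl fun i _ => ?_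
      split_ifs <;> first | omega | simp
    linarith

lemma quarter_le_sum_near {ι : Type*} [Fintype ι] (p : ι → Prop) [DecidablePred p]
    (v z c : ι → ℝ) (hv : ∀ i, 0 ≤ v i) (hz : ∀ i, 0 ≤ z i) (hc : ∀ i, 0 ≤ c i) {d C : ℝ}
    (hd : 0 < d) (hvz : ∀ i, v i ≤ z i * d) (hC : C * d = ∑ i, c i * v i)
    (hp : d ≤ 2 * ∑ i, (if p i then v i else 0)) :
    1 / 4 ≤ ∑ i with 0 < z i ∧ p i ∧ c i ≤ 4 * C, z i := by
  have hC0 : 0 ≤ C := by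
    have : 0 ≤ ∑ i, c i * v i := Finset.sum_nonneg fun i _ => mul_nonneg (hc i) (hv i)
    by_contra h
    push Not at h
    nlinarith
  have hfar : ∑ i, (if 4 * C < c i then v i else 0) ≤ d / 4 := by
    rcases hC0.eq_or_lt with h | h
    · have h0 : ∑ i, c i * v i = 0 := by rw [← hC, ← h, zero_mul]
      rw [Finset.sum_eq_zero]
      · positivity
      · intro i _
        have h1 := (Finset.sum_eq_zero_iff_of_nonneg fun i _ => mul_nonneg (hc i) (hv i)).1 h0 i
          (Finset.mem_univ _)
        split_ifs with h2
        · rcases mul_eq_zero.1 h1 with h3 | h3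
          · linarith
          · exact h3
        · rfl
    · have h1 : (4 * C) * ∑ i, (if 4 * C < c i then v i else 0) ≤ ∑ i, c i * v i := by
        rw [Finset.mul_sum]
        refine Finset.sum_le_sum fun i _ => ?_
        split_ifs with h2
        · exact mul_le_mul_of_nonneg_right h2.le (hv i)
        · rw [mul_zero]
          exact mul_nonneg (hc i) (hv i)
      nlinarith
  have hpt : ∀ i, (if p i then v i else 0) ≤
      (if 0 < z i ∧ p i ∧ c i ≤ 4 * C then z i else 0) * d +
        (if 4 * C < c i then v i else 0) := by
    intro i
    by_cases h1 : p i
    · by_cases h2 : 4 * C < c i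
      · rw [if_pos h1, if_pos h2, if_neg (by intro h; linarith [h.2.2])]
        linarith
      · rcases (hz i).eq_or_lt with h3 | h3
        · have := hvz i
          rw [← h3] at this
          rw [if_pos h1, if_neg h2, if_neg (by rw [← h3]; exact fun h => lt_irrefl _ h.1)]
          linarith
        · rw [if_pos h1, if_neg h2, if_pos ⟨h3, h1, not_lt.1 h2⟩]
          linarith [hvz i]
    · rw [if_neg h1, if_neg (fun h => h1 h.2.1), zero_mul, zero_add]
      split_ifs
      · exact hv i
      · exact le_rfl
  have hsum := Finset.sum_le_sum fun i (_ : i ∈ Finset.univ) => hpt i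
  rw [Finset.sum_add_distrib, ← Finset.sum_mul] at hsum
  rw [Finset.sum_filter]
  nlinarith

lemma exists_rescaling {ι : Type*} [Fintype ι] (p : ι → Prop) [DecidablePred p] (v : ι → ℝ)
    (hv : ∀ i, 0 ≤ v i) {d : ℝ} (hd : 0 ≤ d) (hdp : d ≤ 2 * ∑ i, (if p i then v i else 0)) :
    ∃ r : ι → ℝ, (∀ i, 0 ≤ r i) ∧ (∀ i, ¬ p i → r i = 0) ∧ (∀ i, r i ≤ 2 * v i) ∧
      ∑ i, r i = d := by
  have hl0 : ∀ i, 0 ≤ if p i then v i else 0 := by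
    intro i
    split_ifs
    · exact hv i
    · exact le_rfl
  have hL0 : 0 ≤ ∑ i, (if p i then v i else 0) := Finset.sum_nonneg fun i _ => hl0 i
  refine ⟨fun i => (if p i then v i else 0) * (d / ∑ i, (if p i then v i else 0)), ?_, ?_, ?_, ?_⟩
  · exact fun i => mul_nonneg (hl0 i) (div_nonneg hd hL0)
  · intro i hi
    simp [hi]
  · intro i
    have h1 : d / ∑ i, (if p i then v i else 0) ≤ 2 := div_le_of_le_mul₀ hL0 (by norm_num) hdp
    have h2 : (if p i then v i else 0) ≤ v i := by
      split_ifs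
      · exact le_rfl
      · exact hv i
    rw [mul_comm 2]
    exact mul_le_mul h2 h1 (div_nonneg hd hL0) (hv i)
  · rw [← Finset.sum_mul]
    rcases hL0.eq_or_lt with h | h
    · rw [← h] at hdp ⊢
      linarith
    · exact mul_div_cancel₀ _ h.ne'

set_option maxHeartbeats 800000 in
/-- Rounding of facilities that are all opened to a small fraction `z i`. -/
lemma exists_small_rounding {ι J : Type*} [Fintype ι] [Fintype J]
    (U : ι → ℕ) (o z : ι → ℝ) (ho : ∀ i, 0 ≤ o i) (hz0 : ∀ i, 0 ≤ z i) (hz1 : ∀ i, z i ≤ 1 / 4)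
    (dm : ι ⊕ J → ι ⊕ J → ℝ) (hdm : ∀ u v, 0 ≤ dm u v) (hdm0 : ∀ u, dm u u = 0)
    (hsym : ∀ u v, dm u v = dm v u) (htri : ∀ u v w, dm u w ≤ dm u v + dm v w)
    (v : ι → J → ℝ) (hv : ∀ i j, 0 ≤ v i j) (hvz : ∀ i j, v i j ≤ z i * ∑ i', v i' j)
    (hload : ∀ i, ∑ j, v i j ≤ z i * U i) :
    ∃ (O : Finset ι) (X : ι → J → ℝ), (∀ i j, 0 ≤ X i j) ∧ (∀ i j, i ∉ O → X i j = 0) ∧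
      (∀ j, ∑ i, X i j = ∑ i, v i j) ∧ (∀ i, ∑ j, X i j ≤ U i) ∧ (∀ i ∈ O, 0 < z i) ∧
      ∑ i ∈ O, o i + ∑ i, ∑ j, dm (Sum.inl i) (Sum.inr j) * X i j ≤
        8 * ∑ i, z i * o i + 30 * ∑ i, ∑ j, dm (Sum.inl i) (Sum.inr j) * v i j := by
  classical
  set c : ι → J → ℝ := fun i j => dm (Sum.inl i) (Sum.inr j) with hc
  have hc0 : ∀ i j, 0 ≤ c i j := fun i j => hdm _ _
  set d : J → ℝ := fun j => ∑ i, v i j with hd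
  set C : J → ℝ := fun j => (∑ i, c i j * v i j) / d j with hCdef
  set s : Finset J := Finset.univ.filter fun j => 0 < d j with hs
  have hsd : ∀ j, j ∈ s ↔ 0 < d j := by simp [hs]
  have hd0 : ∀ j, 0 ≤ d j := fun j => Finset.sum_nonneg fun i _ => hv i j
  have hC0 : ∀ j, 0 ≤ C j := fun j =>
    div_nonneg (Finset.sum_nonneg fun i _ => mul_nonneg (hc0 i j) (hv i j)) (hd0 j)
  have hCd : ∀ j, 0 < d j → C j * d j = ∑ i, c i j * v i j := fun j hj =>
    div_mul_cancel₀ _ hj.ne'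
  choose m hlow hhigh using fun j => exists_weighted_median U (fun i => v i j) fun i => hv i j
  obtain ⟨O₁, hO₁, hO₁o, hnear⟩ := exists_cover_rounding s
    (fun j => Finset.univ.filter fun i => 0 < z i ∧ m j ≤ U i ∧ c i j ≤ 4 * C j) C
    (fun i => (U i : ℝ)) o z ho hz0 (τ := 1 / 4) (by norm_num) fun j hj =>
      quarter_le_sum_near (fun i => m j ≤ U i) (fun i => v i j) z (fun i => c i j)
        (fun i => hv i j) hz0 (fun i => hc0 i j) ((hsd j).1 hj) (fun i => hvz i j)
        (hCd j ((hsd j).1 hj)) (hhigh j)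
  have hnear' : ∀ j, 0 < d j → ∃ a ∈ O₁, m j ≤ U a ∧ c a j ≤ 12 * C j := by
    intro j hj
    obtain ⟨a, ha, i, hi, j', hj', hR, hi', ha', hU⟩ := hnear j ((hsd j).2 hj)
    simp only [Finset.mem_filter, Finset.mem_univ, true_and] at hi hi' ha'
    refine ⟨a, ha, hi.2.1.trans (by exact_mod_cast hU), ?_⟩
    have h1 := htri (Sum.inl a) (Sum.inr j') (Sum.inr j)
    have h2 := htri (Sum.inr j') (Sum.inl i) (Sum.inr j)
    rw [hsym (Sum.inr j') (Sum.inl i)] at h2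
    have h3 := hi.2.2
    have h4 := hi'.2.2
    have h5 := ha'.2.2
    simp only [hc] at h3 h4 h5 ⊢
    linarith
  have hξ := fun j => exists_rescaling (fun i => U i ≤ m j) (fun i => v i j) (fun i => hv i j)
    (hd0 j) (hlow j)
  choose ρ hρ0 hρm hρ2 hξd using hξ
  set ξ : ι → J → ℝ := fun i j => ρ j i
  have hξ0 : ∀ i j, 0 ≤ ξ i j := fun i j => hρ0 j i
  have hξ2 : ∀ i j, ξ i j ≤ 2 * v i j := fun i j => hρ2 j i
  have hξpos : ∀ i j, 0 < ξ i j → U i ≤ m j ∧ 0 < d j := by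
    intro i j h
    constructor
    · by_contra h1
      exact h.ne' (hρm j i h1)
    · have h1 : 0 < v i j := by linarith [hξ2 i j]
      exact h1.trans_le (Finset.single_le_sum (fun i _ => hv i j) (Finset.mem_univ i))
  have hw0 : ∀ i, 0 < ∑ j, ξ i j → ∃ j, 0 < ξ i j := by
    intro i hi
    obtain ⟨j, -, hj⟩ := Finset.exists_lt_of_sum_lt (s := Finset.univ) (f := fun _ => (0 : ℝ))
      (g := fun j => ξ i j) (by simpa using hi)
    exact ⟨j, hj⟩
  have hcentre : ∀ i, ∃ a, 0 < ∑ j, ξ i j → (a ∈ O₁ ∧ U i ≤ U a) ∧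
      ∀ j, 0 < ξ i j → dm (Sum.inl a) (Sum.inl i) ≤ c i j + 12 * C j := by
    intro i
    by_cases hi : 0 < ∑ j, ξ i j
    · obtain ⟨j₁, hj₁⟩ := hw0 i hi
      obtain ⟨j₀, hj₀, hmin⟩ := Finset.exists_min_image (Finset.univ.filter fun j => 0 < ξ i j)
        (fun j => c i j + 12 * C j) ⟨j₁, by simpa using hj₁⟩
      have h0 := hξpos i j₀ (Finset.mem_filter.1 hj₀).2
      obtain ⟨a, ha, hma, hca⟩ := hnear' j₀ h0.2
      refine ⟨a, fun _ => ⟨⟨ha, h0.1.trans hma⟩, fun j hj => ?_⟩⟩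
      have h1 := hmin j (Finset.mem_filter.2 ⟨Finset.mem_univ _, hj⟩)
      have h2 := htri (Sum.inl a) (Sum.inr j₀) (Sum.inl i)
      rw [hsym (Sum.inr j₀)] at h2
      simp only [hc] at h1 hca ⊢
      linarith
    · exact ⟨i, fun h => absurd h hi⟩
  choose α hα using hcentre
  have hξload : ∀ i, ∑ j, ξ i j ≤ 2 * (z i * U i) := by
    intro i
    have h1 := Finset.sum_le_sum fun j (_ : j ∈ Finset.univ) => hξ2 i j
    rw [← Finset.mul_sum] at h1
    linarith [hload i]
  obtain ⟨O, X, hX0, hXO, hXd, hXU, hO, hcost⟩ := exists_star_consolidation U o z ho hz0 hz1 c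
    (fun a i => dm (Sum.inl a) (Sum.inl i)) (fun _ _ => hdm _ _) (fun _ => hdm0 _)
    (fun a i k j => by
      have h1 := htri (Sum.inl k) (Sum.inl a) (Sum.inr j)
      have h2 := htri (Sum.inl a) (Sum.inl i) (Sum.inr j)
      rw [hsym (Sum.inl k) (Sum.inl a)] at h1
      simp only [hc]
      linarith) ξ hξ0 O₁ α (fun i hi => (hα i hi).1) hξload
  refine ⟨O, X, hX0, hXO, fun j => (hXd j).trans (hξd j), hXU, ?_, ?_⟩
  · intro i hi
    rcases hO i hi with h | h
    · obtain ⟨j, -, hj⟩ := hO₁ i h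
      exact (Finset.mem_filter.1 hj).2.1
    · rcases (hz0 i).eq_or_lt with h1 | h1
      · have h2 := hξload i
        rw [← h1] at h2
        linarith
      · exact h1
  · have hpt : ∀ i j, ξ i j * (c i j + 2 * dm (Sum.inl (α i)) (Sum.inl i)) ≤
        6 * (c i j * v i j) + 24 * (C j * ξ i j) := by
      intro i j
      have h6 : ξ i j * c i j ≤ 2 * v i j * c i j :=
        mul_le_mul_of_nonneg_right (hξ2 i j) (hc0 i j)
      rcases (hξ0 i j).eq_or_lt with h | h
      · rw [← h]
        have := mul_nonneg (hc0 i j) (hv i j)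
        linarith
      · have h1 := (hα i (h.trans_le (Finset.single_le_sum (fun j _ => hξ0 i j)
          (Finset.mem_univ j)))).2 j h
        have h2 := mul_le_mul_of_nonneg_left h1 h.le
        linarith
    have hsum : ∑ i, ∑ j, ξ i j * (c i j + 2 * dm (Sum.inl (α i)) (Sum.inl i)) ≤
        30 * ∑ i, ∑ j, c i j * v i j := by
      refine (Finset.sum_le_sum fun i _ => Finset.sum_le_sum fun j _ => hpt i j).trans ?_
      simp only [Finset.sum_add_distrib, ← Finset.mul_sum]
      have h1 : ∑ i, ∑ j, C j * ξ i j ≤ ∑ i, ∑ j, c i j * v i j := by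
        rw [Finset.sum_comm, Finset.sum_comm (f := fun i j => c i j * v i j)]
        refine Finset.sum_le_sum fun j _ => ?_
        rw [← Finset.mul_sum, hξd]
        rcases (hd0 j).eq_or_lt with h | h
        · rw [← h, mul_zero]
          exact Finset.sum_nonneg fun i _ => mul_nonneg (hc0 i j) (hv i j)
        · exact (hCd j h).le
      linarith
    linarith

lemma exists_perm_sum_le {n : Type*} [Fintype n] [DecidableEq n] (M : Matrix n n ℝ)
    (hM : M ∈ doublyStochastic ℝ n) (γ : n → n → ℝ) :
    ∃ σ : Equiv.Perm n, (∀ k, 0 < M k (σ k)) ∧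
      ∑ k, γ k (σ k) ≤ ∑ k, ∑ l, γ k l * M k l := by
  obtain ⟨w, hw0, hw1, hwM⟩ := exists_eq_sum_perm_of_mem_doublyStochastic hM
  have hMe : ∀ k l, M k l = ∑ σ : Equiv.Perm n, w σ * (if σ k = l then 1 else 0) := by
    intro k l
    rw [← hwM, Matrix.sum_apply]
    refine Finset.sum_congr rfl fun σ _ => ?_
    simp [Matrix.smul_apply, Equiv.Perm.permMatrix, PEquiv.toMatrix_apply, eq_comm]
  have hcost : ∑ k, ∑ l, γ k l * M k l = ∑ σ : Equiv.Perm n, w σ * ∑ k, γ k (σ k) := by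
    have h1 : ∀ k, ∑ l, γ k l * M k l = ∑ σ : Equiv.Perm n, w σ * γ k (σ k) := by
      intro k
      simp only [hMe, Finset.mul_sum]
      rw [Finset.sum_comm]
      refine Finset.sum_congr rfl fun σ _ => ?_
      simp [mul_comm]
    rw [Finset.sum_congr rfl fun k _ => h1 k, Finset.sum_comm]
    exact Finset.sum_congr rfl fun σ _ => (Finset.mul_sum _ _ _).symm
  have hex : ∃ σ, 0 < w σ ∧ ∑ k, γ k (σ k) ≤ ∑ k, ∑ l, γ k l * M k l := by
    by_contra! h
    have h1 : ∀ σ, w σ * ∑ k, ∑ l, γ k l * M k l ≤ w σ * ∑ k, γ k (σ k) := by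
      intro σ
      rcases (hw0 σ).eq_or_lt with h0 | h0
      · rw [← h0, zero_mul, zero_mul]
      · exact mul_le_mul_of_nonneg_left (h σ h0).le h0.le
    obtain ⟨σ₀, -, hσ₀⟩ := Finset.exists_lt_of_sum_lt (s := Finset.univ)
      (f := fun _ : Equiv.Perm n => (0 : ℝ)) (g := w) (by rw [hw1]; simp)
    have h2 := Finset.sum_lt_sum (fun σ _ => h1 σ)
      ⟨σ₀, Finset.mem_univ _, mul_lt_mul_of_pos_left (h σ₀ hσ₀) hσ₀⟩
    rw [← Finset.sum_mul, hw1, one_mul, ← hcost] at h2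
    exact lt_irrefl _ h2
  obtain ⟨σ, hσ, hle⟩ := hex
  refine ⟨σ, fun k => hσ.trans_le ?_, hle⟩
  rw [hMe]
  have := Finset.single_le_sum (f := fun τ : Equiv.Perm n => w τ * (if τ k = σ k then 1 else 0))
    (fun τ _ => mul_nonneg (hw0 τ) (by split_ifs <;> norm_num)) (Finset.mem_univ σ)
  simpa using this

/-- A capacitated fractional assignment is dominated by an integral one on its support. -/
lemma exists_integral_assignment {ι J : Type*} [Fintype ι] [Fintype J] [DecidableEq ι]
    (U : ι → ℕ) (hU : ∀ i, 0 < U i) (x : ι → J → ℝ) (hx0 : ∀ i j, 0 ≤ x i j)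
    (hx1 : ∀ j, ∑ i, x i j = 1) (hxU : ∀ i, ∑ j, x i j ≤ U i) (c : ι → J → ℝ) :
    ∃ τ : J → ι, (∀ j, 0 < x (τ j) j) ∧ (∀ i, (Finset.univ.filter fun j => τ j = i).card ≤ U i) ∧
      ∑ j, c (τ j) j ≤ ∑ i, ∑ j, c i j * x i j := by
  classical
  have hU' : ∀ i, (0 : ℝ) < U i := fun i => by exact_mod_cast hU i
  have hsig : ∀ f : ι → ℝ, ∑ k : Σ i, Fin (U i), f k.1 / U k.1 = ∑ i, f i := by
    intro f
    rw [Fintype.sum_sigma]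
    refine Finset.sum_congr rfl fun i _ => ?_
    have := (hU' i).ne'
    simp
    field_simp
  have htot : ∑ i, ∑ j, x i j = Fintype.card J := by
    rw [Finset.sum_comm, Finset.sum_congr rfl fun j _ => hx1 j]
    simp
  have hcardK : (Fintype.card (Σ i, Fin (U i)) : ℝ) = ∑ i, (U i : ℝ) := by
    simp [Fintype.card_sigma]
  have hle : Fintype.card J ≤ Fintype.card (Σ i, Fin (U i)) := by
    have := Finset.sum_le_sum fun i (_ : i ∈ Finset.univ) => hxU i
    rw [htot, ← hcardK] at this
    exact_mod_cast this
  obtain ⟨r, hr⟩ := Nat.exists_eq_add_of_le hle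
  have e : (Σ i, Fin (U i)) ≃ J ⊕ Fin r := Fintype.equivOfCardEq (by simp [hr])
  have hs1 : ∀ i, (∑ j, x i j) / U i ≤ 1 := fun i => by
    rw [div_le_one (hU' i)]
    exact hxU i
  have hdef : ∑ k : Σ i, Fin (U i), (1 - (∑ j, x k.1 j) / U k.1) = r := by
    rw [Finset.sum_sub_distrib, hsig fun i => ∑ j, x i j, htot]
    simp only [Finset.sum_const, Finset.card_univ, nsmul_eq_mul, mul_one, hr]
    push_cast
    ring
  let N : (Σ i, Fin (U i)) → J ⊕ Fin r → ℝ := fun k l =>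
    Sum.elim (fun j => x k.1 j / U k.1) (fun _ => (1 - (∑ j, x k.1 j) / U k.1) / r) l
  have hN : Matrix.of (fun k l => N k (e l)) ∈ doublyStochastic ℝ (Σ i, Fin (U i)) := by
    rw [mem_doublyStochastic_iff_sum]
    refine ⟨?_, ?_, ?_⟩
    · intro k l
      rw [Matrix.of_apply]
      rcases e l with j | t
      · exact div_nonneg (hx0 _ _) (hU' _).le
      · exact div_nonneg (by linarith [hs1 k.1]) (Nat.cast_nonneg _)
    · intro k
      simp only [Matrix.of_apply]
      rw [Equiv.sum_comp e (N k), Fintype.sum_sum_type]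
      simp only [N, Sum.elim_inl, Sum.elim_inr, Finset.sum_const, Finset.card_univ,
        Fintype.card_fin, nsmul_eq_mul, ← Finset.sum_div]
      rcases Nat.eq_zero_or_pos r with h | h
      · rw [h, Nat.cast_zero] at hdef
        have h1 := (Finset.sum_eq_zero_iff_of_nonneg fun k _ => by linarith [hs1 k.1]).1 hdef k
          (Finset.mem_univ _)
        rw [h]
        simp
        linarith
      · have : (r : ℝ) ≠ 0 := by positivity
        field_simp
        ring
    · intro l
      simp only [Matrix.of_apply]
      rcases e l with j | t
      · simp only [N, Sum.elim_inl]
        rw [hsig fun i => x i j, hx1]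
      · simp only [N, Sum.elim_inr]
        rw [← Finset.sum_div, hdef]
        have : (r : ℝ) ≠ 0 := by
          have := t.pos
          positivity
        exact div_self this
  obtain ⟨σ, hσ, hcost⟩ := exists_perm_sum_le _ hN fun k l =>
    Sum.elim (fun j => c k.1 j) (fun _ => 0) (e l)
  refine ⟨fun j => (σ.symm (e.symm (Sum.inl j))).1, ?_, ?_, ?_⟩
  · intro j
    have h1 := hσ (σ.symm (e.symm (Sum.inl j)))
    simp only [Matrix.of_apply, Equiv.apply_symm_apply, N, Sum.elim_inl] at h1
    exact (div_pos_iff_of_pos_right (hU' _)).1 h1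
  · intro i
    have h1 : (Finset.univ.filter fun k : Σ i, Fin (U i) => k.1 = i).card = U i := by
      have : (Finset.univ.filter fun k : Σ i, Fin (U i) => k.1 = i) =
          Finset.univ.map ⟨Sigma.mk i, sigma_mk_injective⟩ := by
        ext ⟨a, b⟩
        simp only [Finset.mem_filter, Finset.mem_univ, true_and, Finset.mem_map,
          Function.Embedding.coeFn_mk]
        constructor
        · rintro rfl
          exact ⟨b, rfl⟩
        · rintro ⟨b', h⟩
          exact (congrArg Sigma.fst h).symm
      rw [this]
      simp
    rw [← h1]
    refine Finset.card_le_card_of_injOn (fun j => σ.symm (e.symm (Sum.inl j))) ?_ ?_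
    · intro j hj
      simpa using hj
    · intro j _ j' _ h
      simpa using h
  · have h1 : ∑ k, Sum.elim (fun j => c k.1 j) (fun _ => 0) (e (σ k)) =
        ∑ j, c (σ.symm (e.symm (Sum.inl j))).1 j := by
      rw [← Equiv.sum_comp (e.symm.trans σ.symm), Fintype.sum_sum_type]
      simp
    have h2 : ∀ k : Σ i, Fin (U i), ∑ l, Sum.elim (fun j => c k.1 j) (fun _ => 0) (e l) *
        N k (e l) = (∑ j, c k.1 j * x k.1 j) / U k.1 := by
      intro k
      rw [Equiv.sum_comp e (fun l => Sum.elim (fun j => c k.1 j) (fun _ => 0) l * N k l),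
        Fintype.sum_sum_type]
      simp [N, Finset.sum_div, mul_div_assoc]
    simp only [Matrix.of_apply] at hcost
    rw [h1, Finset.sum_congr rfl fun k _ => h2 k, hsig fun i => ∑ j, c i j * x i j] at hcost
    exact hcost

/-- The arcs of the network, sorted by kind. -/
def MFNArc.equivSum (F D : Type) : MFNArc F D ≃ (F ⊕ D × F) ⊕ (F × D ⊕ F × D) where
  toFun
    | .mid i => .inl (.inl i)
    | .sx j i => .inl (.inr (j, i))
    | .gs i j => .inr (.inl (i, j))
    | .ft i j => .inr (.inr (i, j))
  invFun
    | .inl (.inl i) => .mid i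
    | .inl (.inr p) => .sx p.1 p.2
    | .inr (.inl p) => .gs p.1 p.2
    | .inr (.inr p) => .ft p.1 p.2
  left_inv a := by cases a <;> rfl
  right_inv s := by rcases s with (_ | _) | (_ | _) <;> rfl

lemma sum_mfnArc (φ : MFNArc F D → ℝ) :
    ∑ a, φ a = ((∑ i, φ (.mid i)) + ∑ j, ∑ i, φ (.sx j i)) +
      (∑ i, ∑ j, φ (.gs i j) + ∑ i, ∑ j, φ (.ft i j)) := by
  rw [← Equiv.sum_comp (MFNArc.equivSum F D).symm]
  simp only [Fintype.sum_sum_type, Fintype.sum_prod_type]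
  rfl

lemma netOutflow_eq (f : MFNArc F D → ℝ) (v : MFNNode F D) :
    netOutflow f v = ∑ a : MFNArc F D, (if a.tail = v then f a else 0) -
      ∑ a : MFNArc F D, (if a.head = v then f a else 0) := by
  rw [netOutflow, Finset.sum_filter, Finset.sum_filter]

lemma netOutflow_src (f : MFNArc F D → ℝ) (j : D) :
    netOutflow f (.src j) = ∑ i, f (.sx j i) - ∑ i, f (.gs i j) := by
  rw [netOutflow_eq, sum_mfnArc, sum_mfnArc]
  simp only [MFNArc.tail, MFNArc.head, MFNNode.src.injEq, reduceCtorEq, if_false,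
    Finset.sum_const_zero, Finset.sum_ite_eq', Finset.mem_univ, if_true, zero_add, add_zero]
  rw [Finset.sum_comm]
  simp

lemma netOutflow_fac (f : MFNArc F D → ℝ) (i : F) :
    netOutflow f (.fac i) = f (.mid i) + ∑ j, f (.gs i j) - ∑ j, f (.sx j i) := by
  rw [netOutflow_eq, sum_mfnArc, sum_mfnArc]
  simp [MFNArc.tail, MFNArc.head]

lemma netOutflow_fac' (f : MFNArc F D → ℝ) (i : F) :
    netOutflow f (.fac' i) = ∑ j, f (.ft i j) - f (.mid i) := by
  rw [netOutflow_eq, sum_mfnArc, sum_mfnArc]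
  simp [MFNArc.tail, MFNArc.head]

lemma netOutflow_sink (f : MFNArc F D → ℝ) (j : D) :
    netOutflow f (.sink j) = -∑ i, f (.ft i j) := by
  rw [netOutflow_eq, sum_mfnArc, sum_mfnArc]
  simp [MFNArc.tail, MFNArc.head]

/-- The facility loads `m` and client-to-facility flows `p` of a feasible flow. -/
lemma exists_flow_data {U : F → ℕ} {g x : F → D → ℝ} {y : F → ℝ}
    (h : MFNFeasible U g x y) (dm : F ⊕ D → F ⊕ D → ℝ) (hdm : ∀ u v, 0 ≤ dm u v)
    (hdm0 : ∀ u, dm u u = 0) (hsym : ∀ u v, dm u v = dm v u)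
    (htri : ∀ u v w, dm u w ≤ dm u v + dm v w) :
    ∃ (m : F → D → ℝ) (p : D → F → D → ℝ), (∀ i j, 0 ≤ m i j) ∧ (∀ j i j', 0 ≤ p j i j') ∧
      (∀ i j, m i j ≤ y i * (1 - ∑ i', g i' j)) ∧
      (∀ i, ∑ j, m i j ≤ y i * (U i - ∑ j, g i j)) ∧
      (∀ j, ∑ i, m i j = 1 - ∑ i, g i j) ∧
      (∀ i j', ∑ j, p j i j' ≤ x i j') ∧
      (∀ j j', j' ≠ j → (∀ i, g i j' = 0) → ∀ i, p j i j' = 0) ∧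
      (∀ i, (∀ j, g i j = 0) → ∀ j, m i j = ∑ j', p j i j') ∧
      ∑ i, ∑ j, dm (Sum.inl i) (Sum.inr j) * m i j ≤
        ∑ i, ∑ j, dm (Sum.inl i) (Sum.inr j) * x i j +
          ∑ i, ∑ j, dm (Sum.inl i) (Sum.inr j) * g i j := by
  obtain ⟨f, hf0, hcons, hsrc, hcap⟩ := h
  have hq : ∀ i j', ∑ j, f j (.gs i j') ≤ g i j' := fun i j' => hcap (.gs i j')
  have hp : ∀ i j', ∑ j, f j (.sx j' i) ≤ x i j' := fun i j' => hcap (.sx j' i)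
  have hft0 : ∀ j j' i, j' ≠ j → f j (.ft i j') = 0 := by
    intro j j' i hjj
    have h1 := hcons j (.sink j') (by simp) (by simpa using hjj)
    rw [netOutflow_sink, neg_eq_zero] at h1
    exact (Finset.sum_eq_zero_iff_of_nonneg fun i _ => hf0 j _).1 h1 i (Finset.mem_univ _)
  have hft : ∀ j i, f j (.ft i j) = f j (.mid i) := by
    intro j i
    have h1 := hcons j (.fac' i) (by simp) (by simp)
    rw [netOutflow_fac', Finset.sum_eq_single j (fun j' _ hj' => hft0 j j' i hj') (by simp)] at h1
    linarith
  have hfac : ∀ j i, f j (.mid i) = ∑ j', (f j (.sx j' i) - f j (.gs i j')) := by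
    intro j i
    have h1 := hcons j (.fac i) (by simp) (by simp)
    rw [netOutflow_fac] at h1
    rw [Finset.sum_sub_distrib]
    linarith
  have hcl : ∀ j j', ∑ i, (f j (.sx j' i) - f j (.gs i j')) =
      if j' = j then 1 - ∑ i, g i j else 0 := by
    intro j j'
    rw [Finset.sum_sub_distrib, ← netOutflow_src]
    split_ifs with hj
    · rw [hj]
      exact hsrc j
    · exact hcons j _ (by simpa using hj) (by simp)
  have hq0 : ∀ i j', g i j' = 0 → ∀ j, f j (.gs i j') = 0 := by
    intro i j' h0 j
    have h1 := hq i j'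
    rw [h0] at h1
    have h2 := Finset.single_le_sum (fun j _ => hf0 j (.gs i j')) (Finset.mem_univ j)
    exact le_antisymm (h2.trans h1) (hf0 _ _)
  refine ⟨fun i j => f j (.mid i), fun j i j' => f j (.sx j' i), fun i j => hf0 _ _,
    fun j i j' => hf0 _ _, ?_, fun i => hcap (.mid i), ?_, hp, ?_, ?_, ?_⟩
  · intro i j
    exact (hft j i).symm.trans_le <|
      (Finset.single_le_sum (fun j' _ => hf0 j' (.ft i j)) (Finset.mem_univ j)).trans
      (hcap (.ft i j))
  · intro j
    rw [Finset.sum_congr rfl fun i _ => hfac j i, Finset.sum_comm,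
      Finset.sum_congr rfl fun j' _ => hcl j j']
    simp
  · intro j j' hjj h0 i
    have h1 := hcl j j'
    rw [if_neg hjj, Finset.sum_congr rfl fun i _ => by rw [hq0 i j' (h0 i), sub_zero]] at h1
    exact (Finset.sum_eq_zero_iff_of_nonneg fun i _ => hf0 j _).1 h1 i (Finset.mem_univ _)
  · intro i h0 j
    exact (hfac j i).trans <| Finset.sum_congr rfl fun j' _ => by rw [hq0 i j' (h0 j'), sub_zero]
  · have hone : ∀ j, ∑ i, dm (Sum.inl i) (Sum.inr j) * f j (.mid i) ≤
        ∑ i, ∑ j', dm (Sum.inl i) (Sum.inr j') * (f j (.sx j' i) + f j (.gs i j')) := by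
      intro j
      have h1 : ∑ i, ∑ j', dm (Sum.inr j') (Sum.inr j) * (f j (.sx j' i) - f j (.gs i j')) = 0 := by
        rw [Finset.sum_comm]
        refine Finset.sum_eq_zero fun j' _ => ?_
        rw [← Finset.mul_sum, hcl]
        split_ifs with hj
        · rw [hj, hdm0, zero_mul]
        · rw [mul_zero]
      rw [← sub_zero (∑ i, dm (Sum.inl i) (Sum.inr j) * f j (.mid i)), ← h1,
        ← Finset.sum_sub_distrib]
      refine Finset.sum_le_sum fun i _ => ?_
      rw [hfac, Finset.mul_sum, ← Finset.sum_sub_distrib]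
      refine Finset.sum_le_sum fun j' _ => ?_
      have h2 := htri (Sum.inl i) (Sum.inr j') (Sum.inr j)
      have h3 := htri (Sum.inr j') (Sum.inl i) (Sum.inr j)
      rw [hsym (Sum.inr j') (Sum.inl i)] at h3
      nlinarith [hf0 j (.sx j' i), hf0 j (.gs i j')]
    rw [Finset.sum_comm]
    refine (Finset.sum_le_sum fun j _ => hone j).trans ?_
    rw [Finset.sum_comm, ← Finset.sum_add_distrib]
    refine Finset.sum_le_sum fun i _ => ?_
    rw [Finset.sum_comm, ← Finset.sum_add_distrib]
    refine Finset.sum_le_sum fun j' _ => ?_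
    rw [← Finset.mul_sum, Finset.sum_add_distrib, ← mul_add]
    exact mul_le_mul_of_nonneg_left (add_le_add (hp i j') (hq i j')) (hdm _ _)

/-- A most balanced partial assignment below `b`: facilities `i ∈ B` through which an unsaturated
client could still be served are full and serve unsaturated clients only. -/
lemma exists_balanced_assignment {ι J : Type*} [Fintype ι] [Fintype J] [DecidableEq ι]
    [DecidableEq J] (U : ι → ℕ) (b : ι → J → ℝ) (hb : ∀ i j, 0 ≤ b i j) :
    ∃ (g : ι → J → ℝ) (B : Finset ι), (∀ i j, 0 ≤ g i j) ∧ (∀ i j, g i j ≤ b i j) ∧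
      (∀ j, ∑ i, g i j ≤ 1) ∧ (∀ i, ∑ j, g i j ≤ U i) ∧
      (∀ i ∈ B, ∑ j, g i j = U i ∧ ∃ j, g i j < b i j) ∧
      (∀ i ∈ B, ∀ j, ∑ i', g i' j = 1 → g i j = 0) ∧
      (∀ i, i ∉ B → ∀ j, ∑ i', g i' j < 1 → g i j = b i j) := by
  have hcont : ∀ i j, Continuous fun g : ι → J → ℝ => g i j := fun i j =>
    (continuous_apply j).comp (continuous_apply i)
  let K : Set (ι → J → ℝ) :=
    Set.Icc 0 b ∩ ({g | ∀ j, ∑ i, g i j ≤ 1} ∩ {g | ∀ i, ∑ j, g i j ≤ U i})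
  have hK : IsCompact K := by
    refine isCompact_Icc.inter_right (IsClosed.inter ?_ ?_)
    · rw [Set.ofPred_forall]
      exact isClosed_iInter fun j => isClosed_le
        (continuous_finsetSum _ fun i _ => hcont i j) continuous_const
    · rw [Set.ofPred_forall]
      exact isClosed_iInter fun i => isClosed_le
        (continuous_finsetSum _ fun j _ => hcont i j) continuous_const
  have hKne : K.Nonempty :=
    ⟨0, ⟨⟨le_rfl, hb⟩, by simp, by simp⟩⟩
  have hQ : Continuous fun g : ι → J → ℝ => ∑ j, (1 - ∑ i, g i j) ^ 2 :=
    continuous_finsetSum _ fun j _ =>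
      (continuous_const.sub (continuous_finsetSum _ fun i _ => hcont i j)).pow 2
  obtain ⟨g, ⟨⟨hg0, hgb⟩, hgs, hgU⟩, hmin⟩ := hK.exists_isMinOn hKne hQ.continuousOn
  have hpert : ∀ (i : ι) (e : J → ℝ), (∀ k, 0 ≤ g i k + e k) → (∀ k, g i k + e k ≤ b i k) →
      (∀ k, ∑ i', g i' k + e k ≤ 1) → ∑ k, g i k + ∑ k, e k ≤ U i →
      0 ≤ ∑ k, (e k ^ 2 - 2 * (1 - ∑ i', g i' k) * e k) := by
    intro i e h0 hbe hse hUe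
    have hcol : ∀ k, ∑ a, (g a k + if a = i then e k else 0) = ∑ a, g a k + e k := fun k => by
      rw [Finset.sum_add_distrib]
      simp
    have h1 := hmin (a := fun a k => g a k + if a = i then e k else 0) (by
      refine ⟨⟨fun a k => ?_, fun a k => ?_⟩, fun k => ?_, fun a => ?_⟩
      · by_cases ha : a = i
        · rw [ha]
          simpa using h0 k
        · simpa [ha] using hg0 a k
      · by_cases ha : a = i
        · rw [ha]
          simpa using hbe k
        · simpa [ha] using hgb a k
      · exact (hcol k).trans_le (hse k)
      · by_cases ha : a = i
        · rw [ha]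
          simpa [Finset.sum_add_distrib] using hUe
        · simpa [ha] using hgU a)
    simp only [Set.mem_ofPred_eq, hcol] at h1
    rw [← sub_nonneg, ← Finset.sum_sub_distrib] at h1
    refine h1.trans (le_of_eq (Finset.sum_congr rfl fun k _ => by ring))
  refine ⟨g, Finset.univ.filter fun i => ∃ j, ∑ i', g i' j < 1 ∧ g i j < b i j, hg0, hgb, hgs,
    hgU, ?_, ?_, ?_⟩
  · intro i hi
    obtain ⟨j, hsj, hgj⟩ := (Finset.mem_filter.1 hi).2
    refine ⟨?_, j, hgj⟩
    by_contra hne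
    have hlt : ∑ k, g i k < U i := lt_of_le_of_ne (hgU i) hne
    obtain ⟨ε, hε, hε'⟩ := exists_between (lt_min (sub_pos.2 hsj)
      (lt_min (sub_pos.2 hgj) (sub_pos.2 hlt)))
    rw [lt_min_iff, lt_min_iff] at hε'
    obtain ⟨h1, h2, h3⟩ := hε'
    have h4 := hpert i (fun k => if k = j then ε else 0) (fun k => ?_) (fun k => ?_) (fun k => ?_)
      (by simpa using by linarith)
    · have h5 : ∀ k, ((if k = j then ε else 0) ^ 2 -
          2 * (1 - ∑ i', g i' k) * (if k = j then ε else 0)) =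
          if k = j then ε ^ 2 - 2 * (1 - ∑ i', g i' j) * ε else 0 := by
        intro k
        split_ifs with h
        · rw [h]
        · ring
      rw [Finset.sum_congr rfl fun k _ => h5 k] at h4
      simp only [Finset.sum_ite_eq', Finset.mem_univ, if_true] at h4
      nlinarith
    · have := hg0 i k
      split_ifs <;> simp only [Pi.zero_apply] at this <;> linarith
    · split_ifs with h
      · rw [h]
        linarith
      · linarith [hgb i k]
    · split_ifs with h
      · rw [h]
        linarith
      · linarith [hgs k]
  · intro i hi j' hj'
    obtain ⟨j, hsj, hgj⟩ := (Finset.mem_filter.1 hi).2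
    by_contra hne
    have hjj : j ≠ j' := by
      rintro rfl
      linarith
    have hpos : 0 < g i j' := lt_of_le_of_ne (hg0 i j') (Ne.symm hne)
    obtain ⟨ε, hε, hε'⟩ := exists_between (lt_min (sub_pos.2 hsj)
      (lt_min (sub_pos.2 hgj) hpos))
    rw [lt_min_iff, lt_min_iff] at hε'
    obtain ⟨h1, h2, h3⟩ := hε'
    have h4 := hpert i (fun k => (if k = j then ε else 0) - if k = j' then ε else 0)
      (fun k => ?_) (fun k => ?_) (fun k => ?_)
      (by simpa using hgU i)
    · have h5 : ∀ k, (((if k = j then ε else 0) - if k = j' then ε else 0) ^ 2 -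
          2 * (1 - ∑ i', g i' k) * ((if k = j then ε else 0) - if k = j' then ε else 0)) =
          (if k = j then ε ^ 2 - 2 * (1 - ∑ i', g i' j) * ε else 0) +
            if k = j' then ε ^ 2 + 2 * (1 - ∑ i', g i' j') * ε else 0 := by
        intro k
        by_cases h : k = j
        · have h' : k ≠ j' := h ▸ hjj
          rw [if_pos h, if_neg h', if_pos h, if_neg h', h]
          ring
        · rw [if_neg h, if_neg h]
          split_ifs with h'
          · rw [h']
            ring
          · ring
      rw [Finset.sum_congr rfl fun k _ => h5 k, Finset.sum_add_distrib] at h4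
      simp only [Finset.sum_ite_eq', Finset.mem_univ, if_true, hj'] at h4
      nlinarith
    · have := hg0 i k
      simp only [Pi.zero_apply] at this
      by_cases h : k = j'
      · rw [if_pos h, if_neg (by rw [h]; exact hjj.symm), h]
        linarith
      · rw [if_neg h]
        split_ifs <;> linarith
    · have := hgb i k
      split_ifs with h h' h' <;> first | (rw [h]; linarith) | linarith
    · have := hgs k
      split_ifs with h h' h' <;> first | (rw [h]; linarith) | linarith
  · intro i hi j hj
    by_contra hne
    exact hi (Finset.mem_filter.2 ⟨Finset.mem_univ _, j, hj, lt_of_le_of_ne (hgb i j) hne⟩)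

set_option maxHeartbeats 1000000 in
/-- Rounding of the opening variables only: clients may still be split between facilities. -/
lemma exists_fractional_assignment (U : F → ℕ) (o : F → ℝ) (ho : ∀ i, 0 ≤ o i)
    (dm : F ⊕ D → F ⊕ D → ℝ) (hdm : ∀ u v, 0 ≤ dm u v) (hdm0 : ∀ u, dm u u = 0)
    (hsym : ∀ u v, dm u v = dm v u) (htri : ∀ u v w, dm u w ≤ dm u v + dm v w)
    (x : F → D → ℝ) (y : F → ℝ) (hx : ∀ i j, 0 ≤ x i j) (hy : ∀ i, 0 ≤ y i)
    (hfeas : ∀ g : F → D → ℝ, ValidAssign U g → MFNFeasible U g x y) :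
    ∃ (Y : Finset F) (h : F → D → ℝ), (∀ i j, 0 ≤ h i j) ∧ (∀ i j, i ∉ Y → h i j = 0) ∧
      (∀ j, ∑ i, h i j = 1) ∧ (∀ i, ∑ j, h i j ≤ U i) ∧
      ∑ i ∈ Y, o i + ∑ i, ∑ j, dm (Sum.inl i) (Sum.inr j) * h i j ≤
        24 * ∑ i, o i * y i + 188 * ∑ i, ∑ j, dm (Sum.inl i) (Sum.inr j) * x i j := by
  have hc0 : ∀ i j, 0 ≤ dm (Sum.inl i) (Sum.inr j) := fun i j => hdm _ _
  obtain ⟨g, B, hg0, hgb, hgs, hgU, hBfull, hBsat, hBout⟩ := exists_balanced_assignment U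
    (fun i j => if 1 / 8 ≤ y i then 2 * x i j else 0) (fun i j => by
      split_ifs
      · linarith [hx i j]
      · exact le_rfl)
  have hgx : ∀ i j, g i j ≤ 2 * x i j := by
    intro i j
    have h1 := hgb i j
    have h2 := hx i j
    split_ifs at h1 <;> linarith
  have hgI : ∀ i j, ¬ 1 / 8 ≤ y i → g i j = 0 := by
    intro i j h
    have h1 := hgb i j
    rw [if_neg h] at h1
    exact le_antisymm h1 (hg0 i j)
  set g' : F → D → ℝ := fun i j => if i ∈ B then g i j else 0 with hg'
  have hg'0 : ∀ i j, 0 ≤ g' i j := by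
    intro i j
    simp only [hg']
    split_ifs
    · exact hg0 i j
    · exact le_rfl
  have hg'g : ∀ i j, g' i j ≤ g i j := by
    intro i j
    simp only [hg']
    split_ifs
    · exact le_rfl
    · exact hg0 i j
  have hg'B : ∀ i ∈ B, ∀ j, g' i j = g i j := fun i hi j => if_pos hi
  have hg'N : ∀ i, i ∉ B → ∀ j, g' i j = 0 := fun i hi j => if_neg hi
  have hg's : ∀ j, ∑ i, g' i j ≤ ∑ i, g i j := fun j => Finset.sum_le_sum fun i _ => hg'g i j
  obtain ⟨m, p, hm0, hp0, hmy, hmU, hmd, hpx, hpz, hmp, hmc⟩ := exists_flow_data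
    (hfeas g' ⟨hg'0, fun j => (hg's j).trans (hgs j), fun i =>
      (Finset.sum_le_sum fun j _ => hg'g i j).trans (hgU i)⟩) dm hdm hdm0 hsym htri
  set d : D → ℝ := fun j => 1 - ∑ i, g' i j
  have hd0 : ∀ j, 0 ≤ d j := fun j => by linarith [hg's j, hgs j]
  have hmB : ∀ i ∈ B, ∀ j, m i j = 0 := by
    intro i hi j
    have h1 := hmU i
    rw [Finset.sum_congr rfl fun j _ => hg'B i hi j, (hBfull i hi).1, sub_self, mul_zero] at h1
    exact le_antisymm ((Finset.single_le_sum (fun j _ => hm0 i j) (Finset.mem_univ j)).trans h1)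
      (hm0 i j)
  let A : Finset D := Finset.univ.filter fun j => ∑ i, g i j < 1
  have hA : ∀ j, j ∈ A ↔ ∑ i, g i j < 1 := fun j => by simp [A]
  have hnA : ∀ j, j ∉ A → ∑ i, g i j = 1 := fun j hj =>
    le_antisymm (hgs j) (not_lt.1 fun h => hj ((hA j).2 h))
  have hmA : ∀ i, i ∉ B → ∑ j ∈ A, m i j ≤ ∑ j ∈ A, x i j := by
    intro i hi
    have h1 : ∀ j ∈ A, m i j = ∑ j' ∈ A, p j i j' := by
      intro j hj
      rw [hmp i (hg'N i hi) j]
      refine (Finset.sum_subset (Finset.subset_univ _) fun j' _ hj' => ?_).symm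
      refine hpz j j' (fun h => hj' (h ▸ hj)) (fun i' => ?_) i
      by_cases hi' : i' ∈ B
      · rw [hg'B i' hi', hBsat i' hi' j' (hnA j' hj')]
      · exact hg'N i' hi' j'
    rw [Finset.sum_congr rfl h1, Finset.sum_comm]
    exact Finset.sum_le_sum fun j' _ => (Finset.sum_le_sum_of_subset_of_nonneg
      (Finset.subset_univ A) fun j _ _ => hp0 j i j').trans (hpx i j')
  let μ : D → ℝ := fun j => ∑ i, (if 1 / 8 ≤ y i then m i j else 0)
  let ν : D → ℝ := fun j => ∑ i, (if ¬ 1 / 8 ≤ y i then m i j else 0)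
  have hμ0 : ∀ j, 0 ≤ μ j := fun j => Finset.sum_nonneg fun i _ => by
    split_ifs
    · exact hm0 i j
    · exact le_rfl
  have hν0 : ∀ j, 0 ≤ ν j := fun j => Finset.sum_nonneg fun i _ => by
    split_ifs
    · exact le_rfl
    · exact hm0 i j
  have hμν : ∀ j, μ j + ν j = d j := by
    intro j
    have hdj : d j = ∑ i, m i j := (hmd j).symm
    rw [hdj, ← Finset.sum_add_distrib]
    refine Finset.sum_congr rfl fun i _ => ?_
    by_cases h : 1 / 8 ≤ y i <;> simp only [h, not_true, not_false_eq_true, if_true, if_false,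
      add_zero, zero_add]
  let dw : D → ℝ := fun j => if j ∈ A ∧ ¬ d j ≤ 2 * ν j then d j else 0
  let dv : D → ℝ := fun j => if j ∈ A ∧ d j ≤ 2 * ν j then d j else 0
  have hdw0 : ∀ j, 0 ≤ dw j := fun j => by
    simp only [dw]
    split_ifs
    · exact hd0 j
    · exact le_rfl
  have hdv0 : ∀ j, 0 ≤ dv j := fun j => by
    simp only [dv]
    split_ifs
    · exact hd0 j
    · exact le_rfl
  have hdwμ : ∀ j, dw j ≤ 2 * μ j := fun j => by
    have h1 := hμν j
    have h2 := hμ0 j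
    simp only [dw]
    split_ifs with h
    · linarith [not_le.1 h.2]
    · linarith
  have hdvν : ∀ j, dv j ≤ 2 * ν j := fun j => by
    have h2 := hν0 j
    simp only [dv]
    split_ifs with h
    · exact h.2
    · linarith
  have hdA : ∀ j ∈ A, dw j + dv j = d j := by
    intro j hj
    by_cases h : d j ≤ 2 * ν j <;> simp [dw, dv, hj, h]
  have hdN : ∀ j, j ∉ A → dw j = 0 ∧ dv j = 0 := fun j hj => by simp [dw, dv, hj]
  have hdvd : ∀ j, dv j = d j ∨ dv j = 0 := fun j => by
    by_cases h : j ∈ A ∧ d j ≤ 2 * ν j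
    · exact Or.inl (if_pos h)
    · exact Or.inr (if_neg h)
  choose w hw0 hwI hwm hwd using fun j => exists_rescaling (fun i => 1 / 8 ≤ y i)
    (fun i => m i j) (fun i => hm0 i j) (hdw0 j) (hdwμ j)
  choose v hv0 hvI hvm hvd using fun j => exists_rescaling (fun i => ¬ 1 / 8 ≤ y i)
    (fun i => m i j) (fun i => hm0 i j) (hdv0 j) (hdvν j)
  set z : F → ℝ := fun i => if 1 / 8 ≤ y i then 0 else 2 * y i with hz
  have hz0 : ∀ i, 0 ≤ z i := fun i => by
    have := hy i
    simp only [hz]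
    split_ifs <;> linarith
  obtain ⟨O, X, hX0, hXO, hXd, hXU, hOz, hXc⟩ := exists_small_rounding U o z ho hz0
    (fun i => by
      simp only [hz]
      split_ifs <;> linarith) dm hdm hdm0 hsym htri (fun i j => v j i) (fun i j => hv0 j i)
    (fun i j => by
      rw [hvd]
      by_cases h : 1 / 8 ≤ y i
      · rw [hvI j i (not_not.2 h)]
        exact mul_nonneg (hz0 i) (hdv0 j)
      · simp only [hz, if_neg h]
        rcases hdvd j with h1 | h1
        · rw [h1]
          linarith [hvm j i, hmy i j]
        · have h2 := Finset.single_le_sum (fun i _ => hv0 j i) (Finset.mem_univ i)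
          rw [hvd, h1] at h2
          rw [h1]
          linarith)
    (fun i => by
      by_cases h : 1 / 8 ≤ y i
      · exact (Finset.sum_eq_zero fun j _ => hvI j i (not_not.2 h)).trans_le
          (mul_nonneg (hz0 i) (Nat.cast_nonneg _))
      · have h1 := Finset.sum_le_sum fun j (_ : j ∈ Finset.univ) => hvm j i
        rw [← Finset.mul_sum] at h1
        have h2 : 0 ≤ y i * ∑ j, g' i j :=
          mul_nonneg (hy i) (Finset.sum_nonneg fun j _ => hg'0 i j)
        simp only [hz, if_neg h]
        linarith [hmU i])
  have hOy : ∀ i ∈ O, ¬ 1 / 8 ≤ y i := by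
    intro i hi h
    have h1 := hOz i hi
    simp only [hz, if_pos h, lt_irrefl] at h1
  let I : Finset F := Finset.univ.filter fun i => 1 / 8 ≤ y i
  have hI : ∀ i, i ∈ I ↔ 1 / 8 ≤ y i := fun i => by simp [I]
  let r : F → D → ℝ := fun i j => if j ∈ A then g' i j else g i j
  have hr0 : ∀ i j, 0 ≤ r i j := fun i j => by
    simp only [r]
    split_ifs
    · exact hg'0 i j
    · exact hg0 i j
  have hrg : ∀ i j, r i j ≤ g i j := fun i j => by
    simp only [r]
    split_ifs
    · exact hg'g i j
    · exact le_rfl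
  refine ⟨I ∪ O, fun i j => r i j + w j i + X i j, ?_, ?_, ?_, ?_, ?_⟩
  · exact fun i j => add_nonneg (add_nonneg (hr0 i j) (hw0 j i)) (hX0 i j)
  · intro i j hi
    rw [Finset.mem_union, not_or, hI] at hi
    have h1 : r i j = 0 := le_antisymm ((hrg i j).trans (hgI i j hi.1).le) (hr0 i j)
    show r i j + w j i + X i j = 0
    rw [h1, hwI j i hi.1, hXO i j hi.2]
    norm_num
  · intro j
    rw [Finset.sum_add_distrib, Finset.sum_add_distrib, hwd, hXd, hvd]
    by_cases hj : j ∈ A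
    · simp only [r, if_pos hj]
      linarith [hdA j hj]
    · simp only [r, if_neg hj]
      linarith [hnA j hj, (hdN j hj).1, (hdN j hj).2]
  · intro i
    rw [Finset.sum_add_distrib, Finset.sum_add_distrib]
    by_cases hi : 1 / 8 ≤ y i
    · have hXi : ∑ j, X i j = 0 :=
        Finset.sum_eq_zero fun j _ => hXO i j fun h => hOy i h hi
      rw [hXi, add_zero, ← Finset.sum_add_distrib]
      by_cases hiB : i ∈ B
      · refine (Finset.sum_le_sum fun j _ => ?_).trans (hgU i)
        linarith [hrg i j, hwm j i, hmB i hiB j]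
      · have h1 : ∀ j, r i j + w j i ≤
            (if j ∈ A then 2 * (m i j - x i j) else 0) + g i j := by
          intro j
          by_cases hj : j ∈ A
          · have h2 := hBout i hiB j ((hA j).1 hj)
            rw [if_pos hi] at h2
            simp only [r, if_pos hj, hg'N i hiB j, h2]
            linarith [hwm j i]
          · have h2 := Finset.single_le_sum (fun i _ => hw0 j i) (Finset.mem_univ i)
            rw [hwd, (hdN j hj).1] at h2
            simp only [r, if_neg hj]
            linarith
        refine (Finset.sum_le_sum fun j _ => h1 j).trans ?_
        rw [Finset.sum_add_distrib, Finset.sum_ite_mem, Finset.univ_inter, ← Finset.mul_sum,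
          Finset.sum_sub_distrib]
        linarith [hmA i hiB, hgU i]
    · have h1 : ∑ j, r i j = 0 := Finset.sum_eq_zero fun j _ =>
        le_antisymm ((hrg i j).trans (hgI i j hi).le) (hr0 i j)
      have h2 : ∑ j, w j i = 0 := Finset.sum_eq_zero fun j _ => hwI j i hi
      rw [h1, h2, add_zero, zero_add]
      exact hXU i
  · have hcmono : ∀ (a b : F → D → ℝ) (k : ℝ), (∀ i j, a i j ≤ k * b i j) →
        ∑ i, ∑ j, dm (Sum.inl i) (Sum.inr j) * a i j ≤
          k * ∑ i, ∑ j, dm (Sum.inl i) (Sum.inr j) * b i j := by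
      intro a b k hab
      simp only [Finset.mul_sum]
      refine Finset.sum_le_sum fun i _ => Finset.sum_le_sum fun j _ => ?_
      nlinarith [mul_le_mul_of_nonneg_left (hab i j) (hc0 i j)]
    have hcr := hcmono r x 2 fun i j => (hrg i j).trans (hgx i j)
    have hcg := hcmono g' x 2 fun i j => (hg'g i j).trans (hgx i j)
    have hcw := hcmono (fun i j => w j i) m 2 fun i j => hwm j i
    have hcv := hcmono (fun i j => v j i) m 2 fun i j => hvm j i
    have hoI : ∑ i ∈ I, o i ≤ 8 * ∑ i, o i * y i := by
      rw [Finset.mul_sum, Finset.sum_filter]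
      refine Finset.sum_le_sum fun i _ => ?_
      have := mul_nonneg (ho i) (hy i)
      split_ifs with h
      · nlinarith [ho i]
      · linarith
    have hoz : ∑ i, z i * o i ≤ 2 * ∑ i, o i * y i := by
      rw [Finset.mul_sum]
      refine Finset.sum_le_sum fun i _ => ?_
      have := mul_nonneg (ho i) (hy i)
      simp only [hz]
      split_ifs with h <;> linarith
    have ho_union : ∑ i ∈ I ∪ O, o i ≤ ∑ i ∈ I, o i + ∑ i ∈ O, o i := by
      rw [← Finset.sum_union_inter]
      linarith [Finset.sum_nonneg fun i (_ : i ∈ I ∩ O) => ho i]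
    simp only [mul_add, Finset.sum_add_distrib]
    linarith

/-- MFNLP has integrality gap at most `288`: every MFNLP-feasible
pair admits an integral solution of cost at most `288` times larger. -/
theorem stmt_16 (U : F → ℕ) (hU : ∀ i, 0 < U i)
    (o : F → ℝ) (ho : ∀ i, 0 ≤ o i)
    (dmet : F ⊕ D → F ⊕ D → ℝ)
    (hd0 : ∀ u, dmet u u = 0)
    (hdsym : ∀ u v, dmet u v = dmet v u)
    (hdtri : ∀ u v w, dmet u w ≤ dmet u v + dmet v w)
    (x : F → D → ℝ) (y : F → ℝ)
    (hx : ∀ i j, 0 ≤ x i j ∧ x i j ≤ 1) (hy : ∀ i, 0 ≤ y i ∧ y i ≤ 1)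
    (hfeas : ∀ g : F → D → ℝ, ValidAssign U g → MFNFeasible U g x y) :
    ∃ (xb : F → D → ℝ) (yb : F → ℝ),
      IsIntegralSolution U xb yb ∧
        cflCost o (fun i j => dmet (Sum.inl i) (Sum.inr j)) xb yb ≤
          288 * cflCost o (fun i j => dmet (Sum.inl i) (Sum.inr j)) x y := by
  have hdm : ∀ u v, 0 ≤ dmet u v := by
    intro u v
    have h := hdtri u v u
    rw [hd0, hdsym v u] at h
    linarith
  obtain ⟨Y, h, hh0, hhY, hh1, hhU, hhc⟩ := exists_fractional_assignment U o ho dmet hdm hd0 hdsym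
    hdtri x y (fun i j => (hx i j).1) (fun i => (hy i).1) hfeas
  obtain ⟨τ, hτpos, hτU, hτc⟩ := exists_integral_assignment U hU h hh0 hh1 hhU
    fun i j => dmet (Sum.inl i) (Sum.inr j)
  have hτY : ∀ j, τ j ∈ Y := fun j => by
    by_contra hj
    exact (hτpos j).ne' (hhY _ j hj)
  refine ⟨fun i j => if τ j = i then 1 else 0, fun i => if i ∈ Y then 1 else 0,
    ⟨?_, ?_, ?_, ?_, ?_⟩, ?_⟩
  · intro i j
    by_cases hi : τ j = i <;> simp [hi]
  · intro i
    by_cases hi : i ∈ Y <;> simp [hi]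
  · intro i j
    by_cases hi : τ j = i
    · simp [hi, hi ▸ hτY j]
    · by_cases hiY : i ∈ Y <;> simp [hi, hiY]
  · intro j
    simp
  · intro i
    by_cases hi : i ∈ Y
    · simpa [hi] using hτU i
    · have : ∀ j, τ j ≠ i := fun j hj => hi (hj ▸ hτY j)
      simp [this, hi]
  · have h1 : 0 ≤ ∑ i, o i * y i := Finset.sum_nonneg fun i _ => mul_nonneg (ho i) (hy i).1
    have h2 : 0 ≤ ∑ i, ∑ j, dmet (Sum.inl i) (Sum.inr j) * x i j :=
      Finset.sum_nonneg fun i _ => Finset.sum_nonneg fun j _ => mul_nonneg (hdm _ _) (hx i j).1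
    have h3 : ∑ i, o i * (if i ∈ Y then 1 else 0) = ∑ i ∈ Y, o i := by simp
    have h4 : ∑ i, ∑ j, dmet (Sum.inl i) (Sum.inr j) * (if τ j = i then 1 else 0) =
        ∑ j, dmet (Sum.inl (τ j)) (Sum.inr j) := by
      rw [Finset.sum_comm]
      simp
    simp only [cflCost]
    rw [h3, h4]
    linarith
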